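/- arXiv:2103.06825 — 2 statements merged into one kernel-verified Lean document; each statement's English description precedes it below -/
import Mathlib

section
/- Let m = (m₁, m₂, …) and n = (n₁, n₂, …) be sequences of integers with every mᵢ ≥ 2 and nᵢ ≥ 2, and let S(m) denote the one-dimensional solenoid, i.e. the subspace of the product ∏_{ℓ≥0} ℝ/ℤ consisting of all sequences (x₀, x₁, x₂, …) with x_{ℓ−1} = m_ℓ · x_ℓ for all ℓ ≥ 1 (and S(n) defined analogously from n). Then S(m) and S(n) are homeomorphic topological spaces if and only if the Steinitz numbers Π[m] = LCM{ m₁m₂⋯m_ℓ : ℓ ≥ 1 } and Π[n] = LCM{ n₁n₂⋯n_ℓ : ℓ ≥ 1 } are asymptotically equivalent. -/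
noncomputable section

open Set Topology

/-! ### Steinitz (supernatural) numbers -/

/-- A Steinitz number: a formal product of primes with exponents in `ℕ∞`. -/
def SteinitzNum : Type := Nat.Primes → ℕ∞

namespace SteinitzNum

/-- The Steinitz number associated to a natural number. -/
def ofNat (n : ℕ) : SteinitzNum := fun p => (n.factorization (p : ℕ) : ℕ∞)

/-- Multiplication of Steinitz numbers adds the exponents at each prime. -/
instance : Mul SteinitzNum := ⟨fun a b p => a p + b p⟩

/-- The least common multiple of a collection of positive integers, as a Steinitz number:
its exponent at `p` is the supremum of the `p`-adic valuations of the elements. -/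
def lcmSet (S : Set ℕ) : SteinitzNum := fun p => ⨆ n ∈ S, (n.factorization (p : ℕ) : ℕ∞)

/-- Two Steinitz numbers are asymptotically equivalent if they agree after multiplication
by positive integers. -/
def AsympEquiv (a b : SteinitzNum) : Prop :=
  ∃ n₀ m₀ : ℕ, 0 < n₀ ∧ 0 < m₀ ∧ ofNat n₀ * a = ofNat m₀ * b

/-- The prime spectrum of a Steinitz number: primes with nonzero exponent. -/
def primeSpectrum (a : SteinitzNum) : Set Nat.Primes := { p | a p ≠ 0 }

/-- The finite prime spectrum: primes with finite nonzero exponent. -/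
def finitePrimeSpectrum (a : SteinitzNum) : Set Nat.Primes := { p | a p ≠ 0 ∧ a p ≠ ⊤ }

/-- The infinite prime spectrum: primes with infinite exponent. -/
def infinitePrimeSpectrum (a : SteinitzNum) : Set Nat.Primes := { p | a p = ⊤ }

end SteinitzNum

/-! ### Steinitz orders for topological groups -/

/-- The Steinitz order of a topological group: the LCM of the orders of the finite
quotients `G/N` over open normal subgroups `N ⊆ G`. -/
def steinitzOrder (G : Type*) [Group G] [TopologicalSpace G] : SteinitzNum :=
  SteinitzNum.lcmSet
    { n | ∃ N : Subgroup G, N.Normal ∧ IsOpen (N : Set G) ∧ n = Nat.card (G ⧸ N) }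

/-- The Steinitz order of a subgroup `D` of a topological group `G`: the LCM of the
cardinalities `|D/(N ∩ D)|` over open normal subgroups `N ⊆ G`. -/
def steinitzOrderOfSubgroup {G : Type*} [Group G] [TopologicalSpace G] (D : Subgroup G) :
    SteinitzNum :=
  SteinitzNum.lcmSet
    { n | ∃ N : Subgroup G, N.Normal ∧ IsOpen (N : Set G) ∧
        n = Nat.card (↥D ⧸ (N.subgroupOf D)) }

/-- The relative Steinitz order of a subgroup `D` of a topological group `G`: the LCM of the
cardinalities `|G/(N · D)|` over open normal subgroups `N ⊆ G`. -/
def steinitzRelativeOrder {G : Type*} [Group G] [TopologicalSpace G] (D : Subgroup G) :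
    SteinitzNum :=
  SteinitzNum.lcmSet
    { n | ∃ N : Subgroup G, N.Normal ∧ IsOpen (N : Set G) ∧ n = Nat.card (G ⧸ (N ⊔ D)) }

/-- A profinite (compact Hausdorff totally disconnected) topological group is topologically
Noetherian if every increasing chain of closed subgroups has a maximal element. -/
def TopologicallyNoetherian (G : Type*) [Group G] [TopologicalSpace G] : Prop :=
  ∀ c : ℕ → Subgroup G, (∀ i, IsClosed (c i : Set G)) → Monotone c → ∃ i₀, ∀ i, c i ≤ c i₀

/-- The one-dimensional solenoid determined by a sequence of integers `m`: the inverse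
limit of the degree-`m ℓ` self-covers of the circle `ℝ/ℤ`, realized as the set of
sequences `(x₀, x₁, …)` in `ℝ/ℤ` with `x ℓ = m ℓ • x (ℓ+1)` for all `ℓ`. -/
def oneSolenoid (m : ℕ → ℕ) : Type :=
  { x : ℕ → AddCircle (1 : ℝ) // ∀ ℓ, x ℓ = (m ℓ) • x (ℓ + 1) }

instance (m : ℕ → ℕ) : TopologicalSpace (oneSolenoid m) :=
  inferInstanceAs
    (TopologicalSpace { x : ℕ → AddCircle (1 : ℝ) // ∀ ℓ, x ℓ = (m ℓ) • x (ℓ + 1) })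

namespace SolenoidProof

open SteinitzNum

abbrev T : Type := AddCircle (1 : ℝ)

/-- partial products -/
def MM (m : ℕ → ℕ) (l : ℕ) : ℕ := ∏ i ∈ Finset.range l, m i

lemma MM_pos {m : ℕ → ℕ} (hm : ∀ i, 2 ≤ m i) (l : ℕ) : 0 < MM m l :=
  Finset.prod_pos fun i _ => lt_of_lt_of_le (by norm_num) (hm i)

lemma MM_succ (m : ℕ → ℕ) (l : ℕ) : MM m (l + 1) = MM m l * m l :=
  Finset.prod_range_succ _ _

lemma MM_dvd (m : ℕ → ℕ) {i l : ℕ} (h : i ≤ l) : MM m i ∣ MM m l := by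
  induction l, h using Nat.le_induction with
  | base => exact dvd_rfl
  | succ l _ ih => rw [MM_succ]; exact ih.mul_right _

lemma coord {m : ℕ → ℕ} (hm : ∀ i, 2 ≤ m i) (x : oneSolenoid m) {i l : ℕ} (h : i ≤ l) :
    ∀ c, MM m l = MM m i * c → x.1 i = c • x.1 l := by
  induction l, h using Nat.le_induction with
  | base =>
    intro c hc
    have : c = 1 := by
      have := MM_pos hm i
      nlinarith
    simp [this]
  | succ l h ih =>
    intro c hc
    obtain ⟨d, hd⟩ := MM_dvd m h
    have h1 : c = d * m l := by
      rw [MM_succ, hd, mul_assoc] at hc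
      exact (Nat.eq_of_mul_eq_mul_left (MM_pos hm i) hc).symm
    rw [ih d hd, x.2 l, h1, mul_smul]

lemma continuous_coord {m : ℕ → ℕ} (i : ℕ) : Continuous (fun x : oneSolenoid m => x.1 i) :=
  (continuous_apply i).comp continuous_subtype_val

instance {m : ℕ → ℕ} : CompactSpace (oneSolenoid m) := by
  have : IsClosed {x : ℕ → AddCircle (1 : ℝ) | ∀ l, x l = (m l) • x (l + 1)} := by
    simp only [Set.ofPred_forall]
    exact isClosed_iInter fun l => isClosed_eq (continuous_apply l)
      ((continuous_apply (l + 1)).nsmul _)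
  exact isCompact_iff_compactSpace.mp this.isCompact

/-- the line through zero -/
def line {m : ℕ → ℕ} (hm : ∀ i, 2 ≤ m i) (t : ℝ) : oneSolenoid m :=
  ⟨fun j => ((t / MM m j : ℝ) : T), fun l => by
    have h1 : (MM m l : ℝ) ≠ 0 := by exact_mod_cast (MM_pos hm l).ne'
    have h2 : (m l : ℝ) ≠ 0 := by
      have := hm l
      positivity
    rw [← AddCircle.coe_nsmul, MM_succ]
    congr 1
    simp only [nsmul_eq_mul]
    push_cast
    field_simp⟩

lemma line_apply {m : ℕ → ℕ} (hm : ∀ i, 2 ≤ m i) (t : ℝ) (j : ℕ) :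
    (line hm t).1 j = ((t / MM m j : ℝ) : T) := rfl

lemma continuous_line {m : ℕ → ℕ} (hm : ∀ i, 2 ≤ m i) : Continuous (line hm) := by
  refine Continuous.subtype_mk (continuous_pi fun j => ?_) _
  exact (AddCircle.continuous_mk' 1).comp (continuous_id.div_const _)

/-- a character with a real lift is trivial -/
lemma eq_zero_of_lift {m : ℕ → ℕ} (hm : ∀ i, 2 ≤ m i) (k : ℤ) (l : ℕ)
    (u : C(oneSolenoid m, ℝ)) (h : ∀ x, k • x.1 l = ((u x : ℝ) : T)) : k = 0 := by
  set r : ℝ := k / MM m l with hr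
  have hM : (MM m l : ℝ) ≠ 0 := by exact_mod_cast (MM_pos hm l).ne'
  let v : ℝ → ℝ := fun t => u (line hm t)
  have hv : Continuous v := u.continuous.comp (continuous_line hm)
  have hIntVal : ∀ t, ∃ z : ℤ, (z : ℝ) = v t - r * t := by
    intro t
    have h1 := h (line hm t)
    rw [line_apply, ← AddCircle.coe_zsmul, eq_comm, ← sub_eq_zero, ← AddCircle.coe_sub,
      AddCircle.coe_eq_zero_iff] at h1
    obtain ⟨z, hz⟩ := h1
    refine ⟨z, ?_⟩
    simp only [zsmul_eq_mul, mul_one] at hz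
    rw [hz, hr]
    simp only [v]
    ring
  have hc : Continuous fun t => v t - r * t := by fun_prop
  have hconst : ∀ t, v t - r * t = v 0 - r * 0 := by
    choose z hz using hIntVal
    have hz' : (fun t => (z t : ℝ)) = fun t => v t - r * t := funext hz
    have hzc : Continuous z := by
      rw [Int.isClosedEmbedding_coe_real.isEmbedding.continuous_iff]
      change Continuous (fun t => (z t : ℝ))
      rw [hz']; exact hc
    intro t
    have := PreconnectedSpace.constant (inferInstance : PreconnectedSpace ℝ) hzc (x := t) (y := 0)
    rw [← hz, ← hz, this]
  obtain ⟨C, hC⟩ := isCompact_univ.exists_bound_of_continuousOn (f := u) u.continuous.continuousOn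
  by_contra hk
  have hr0 : r ≠ 0 := by
    rw [hr]; exact div_ne_zero (by exact_mod_cast hk) hM
  have h1 := hconst ((2 * C + 1) / r)
  have h2 : r * ((2 * C + 1) / r) = 2 * C + 1 := by field_simp
  have h3 := hC (line hm ((2 * C + 1) / r)) (mem_univ _)
  have h4 := hC (line hm 0) (mem_univ _)
  rw [Real.norm_eq_abs, abs_le] at h3 h4
  simp only [v] at h1
  rw [h2] at h1
  linarith [h3.1, h3.2, h4.1, h4.2]

lemma lift_small {X : Type*} [TopologicalSpace X] (f : C(X, T)) (h : ∀ x, ‖f x‖ < 1 / 2) :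
    ∃ u : C(X, ℝ), ∀ x, f x = ((u x : ℝ) : T) := by
  let e := AddCircle.openPartialHomeomorphCoe (1 : ℝ) (-(1 / 2) : ℝ)
  have ht : ∀ x, f x ∈ e.target := by
    intro x
    change f x ∈ ({((-(1 / 2) : ℝ) : T)}ᶜ : Set T)
    simp only [mem_compl_iff, mem_singleton_iff]
    intro hx
    have := h x
    rw [hx, AddCircle.coe_neg, norm_neg, UnitAddCircle.norm_eq] at this
    norm_num [round_eq] at this
  refine ⟨⟨fun x => e.symm (f x), ?_⟩, fun x => ?_⟩
  · exact e.continuousOn_symm.comp_continuous f.continuous ht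
  · exact (e.right_inv (ht x)).symm

lemma exists_level {m : ℕ → ℕ} (hm : ∀ i, 2 ≤ m i) (f : C(oneSolenoid m, T)) :
    ∃ l, ∀ x y : oneSolenoid m, x.1 l = y.1 l → ‖f x - f y‖ < 1 / 8 := by
  by_contra! hcon
  let t : ℕ → Set (oneSolenoid m × oneSolenoid m) := fun l =>
    {p | p.1.1 l = p.2.1 l ∧ 1 / 8 ≤ ‖f p.1 - f p.2‖}
  have hcl : ∀ l, IsClosed (t l) := fun l =>
    (isClosed_eq ((continuous_coord l).comp continuous_fst)
      ((continuous_coord l).comp continuous_snd)).inter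
      (isClosed_le continuous_const
        ((f.continuous.comp continuous_fst).sub (f.continuous.comp continuous_snd)).norm)
  obtain ⟨p, hp⟩ := IsCompact.nonempty_iInter_of_sequence_nonempty_isCompact_isClosed t
    (fun l p hp => ⟨by rw [p.1.2 l, p.2.2 l, hp.1], hp.2⟩)
    (fun l => by obtain ⟨x, y, h⟩ := hcon l; exact ⟨(x, y), h⟩)
    (hcl 0).isCompact hcl
  simp only [mem_iInter] at hp
  have h1 : p.1 = p.2 := Subtype.ext (funext fun l => (hp l).1)
  have h2 := (hp 0).2
  rw [h1] at h2
  norm_num at h2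

lemma norm_coe_le (r : ℝ) : ‖((r : ℝ) : T)‖ ≤ |r| := by
  rw [UnitAddCircle.norm_eq]
  simpa using round_le r 0

/-- every map to the circle is a character plus a real function -/
lemma exists_deg {m : ℕ → ℕ} (hm : ∀ i, 2 ≤ m i) (f : C(oneSolenoid m, T)) :
    ∃ (l : ℕ) (k : ℤ) (u : C(oneSolenoid m, ℝ)), ∀ x, f x = k • x.1 l + ((u x : ℝ) : T) := by
  obtain ⟨l, hl⟩ := exists_level hm f
  have hM : (MM m l : ℝ) ≠ 0 := by exact_mod_cast (MM_pos hm l).ne'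
  let s : ℝ → oneSolenoid m := fun t => line hm (MM m l * t)
  have hs : Continuous s := (continuous_line hm).comp (by fun_prop)
  have hsl : ∀ t, (s t).1 l = ((t : ℝ) : T) := by
    intro t
    simp only [s, line_apply]
    congr 1
    field_simp
  obtain ⟨e0, he0⟩ := QuotientAddGroup.mk_surjective (f (s 0))
  obtain ⟨F, ⟨-, hF⟩, -⟩ := (AddCircle.isCoveringMap_coe (1 : ℝ)).existsUnique_continuousMap_lifts
    (f.comp ⟨s, hs⟩) 0 e0 he0
  have hF' : ∀ t, ((F t : ℝ) : T) = f (s t) := fun t => congrFun hF t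
  set D : ℝ := F 1 - F 0 with hD
  have hDn : |D - round D| < 1 / 8 := by
    rw [← UnitAddCircle.norm_eq, hD, AddCircle.coe_sub]
    have := hl (s 1) (s 0) (by
      rw [hsl, hsl, AddCircle.coe_period]; simp)
    rw [← hF', ← hF'] at this
    exact this
  set k : ℤ := round D with hk
  let g : ℝ → ℝ := fun t => F t - t * D
  have hg : Continuous g := by fun_prop
  let G : C(T, ℝ) := ⟨AddCircle.liftIco 1 0 g, AddCircle.liftIco_zero_continuous
    (by simp [g, hD]) hg.continuousOn⟩
  let f1 : C(oneSolenoid m, T) := ⟨fun x => f x - k • x.1 l - ((G (x.1 l) : ℝ) : T), by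
    have h1 := continuous_coord (m := m) l
    have h2 : Continuous fun x : oneSolenoid m => ((G (x.1 l) : ℝ) : T) :=
      (AddCircle.continuous_mk' 1).comp (G.continuous.comp h1)
    exact (f.continuous.sub (h1.zsmul k)).sub h2⟩
  obtain ⟨u, hu⟩ := lift_small f1 (by
    intro x
    obtain ⟨t, ht, htx⟩ : ∃ t ∈ Ico (0 : ℝ) 1, ((t : ℝ) : T) = x.1 l := by
      have h0 := AddCircle.coe_image_Ico_eq (1 : ℝ) 0
      have : x.1 l ∈ ((↑) : ℝ → T) '' Ico (0 : ℝ) (0 + 1) := by rw [h0]; trivial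
      simpa using this
    have hGt : G (x.1 l) = F t - t * D := by
      rw [← htx]
      exact AddCircle.liftIco_zero_coe_apply (f := g) ht
    have e1 : f1 x = (f x - f (s t)) + ((t * (D - k) : ℝ) : T) := by
      change f x - k • x.1 l - ((G (x.1 l) : ℝ) : T) = _
      rw [hGt, ← htx, ← hF', ← AddCircle.coe_zsmul, sub_sub, ← AddCircle.coe_add,
        sub_add, ← AddCircle.coe_sub]
      congr 2
      simp only [zsmul_eq_mul]
      ring
    rw [e1]
    have h1 := hl x (s t) (by rw [hsl, htx])
    have h2 := norm_coe_le (t * (D - k))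
    rw [abs_mul, abs_of_nonneg ht.1] at h2
    have h3 : t * |D - k| ≤ 1 * |D - k| := mul_le_mul_of_nonneg_right ht.2.le (abs_nonneg _)
    have h4 := norm_add_le (f x - f (s t)) ((t * (D - k) : ℝ) : T)
    linarith)
  refine ⟨l, k, u + G.comp ⟨_, continuous_coord l⟩, fun x => ?_⟩
  have := hu x
  change f x - k • x.1 l - ((G (x.1 l) : ℝ) : T) = _ at this
  change f x = k • x.1 l + ((u x + G (x.1 l) : ℝ) : T)
  rw [AddCircle.coe_add, ← this]
  abel

/-- the key divisibility consequence of a homeomorphism -/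
lemma dvd_of_homeo {m n : ℕ → ℕ} (hm : ∀ i, 2 ≤ m i) (hn : ∀ i, 2 ≤ n i)
    (h : oneSolenoid m ≃ₜ oneSolenoid n) :
    ∃ k : ℕ, 0 < k ∧ ∀ j, ∃ l, MM n j ∣ k * MM m l := by
  let y : ℕ → C(oneSolenoid m, T) := fun j => ⟨fun x => (h x).1 j,
    (continuous_coord j).comp h.continuous⟩
  have hy : ∀ j x, y j x = (h x).1 j := fun _ _ => rfl
  obtain ⟨l, k, u, hu⟩ := exists_deg hm (y 0)
  have hk : k ≠ 0 := by
    rintro rfl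
    have := eq_zero_of_lift hn 1 0 (u.comp ⟨h.symm, h.symm.continuous⟩) (by
      intro z
      have := hu (h.symm z)
      simpa [hy] using this)
    omega
  refine ⟨k.natAbs, Int.natAbs_pos.mpr hk, fun j => ?_⟩
  obtain ⟨l', k', u', hu'⟩ := exists_deg hm (y j)
  obtain ⟨a, ha⟩ := MM_dvd m (le_max_left l l')
  obtain ⟨b, hb⟩ := MM_dvd m (le_max_right l l')
  have key : k * a - MM n j * (k' * b) = 0 := by
    refine eq_zero_of_lift hm _ (max l l') ((MM n j : ℝ) • u' - u) fun x => ?_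
    have h1 := hu x
    have h2 := hu' x
    have h3 : y 0 x = MM n j • y j x := by
      rw [hy, hy]
      exact coord hn (h x) (Nat.zero_le j) _ (by simp [MM])
    rw [coord hm x (le_max_left l l') a ha] at h1
    rw [coord hm x (le_max_right l l') b hb] at h2
    rw [h1, h2] at h3
    change _ = (((MM n j : ℝ) * u' x - u x : ℝ) : T)
    have e0 : (MM n j : ℝ) * u' x = MM n j • u' x := (nsmul_eq_mul _ _).symm
    rw [e0, AddCircle.coe_sub, AddCircle.coe_nsmul, sub_smul, mul_smul, mul_smul,
      mul_smul, natCast_zsmul, natCast_zsmul, natCast_zsmul, sub_eq_sub_iff_add_eq_add, h3,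
      nsmul_add, add_comm]
  refine ⟨max l l', ?_⟩
  have h1 : MM n j ∣ (k * a).natAbs := by
    rw [← Int.natCast_dvd]
    exact ⟨k' * b, by linarith⟩
  rw [Int.natAbs_mul, Int.natAbs_natCast] at h1
  rw [ha, mul_left_comm]
  exact h1.mul_left _

/-- The Steinitz number of a sequence. -/
abbrev St (m : ℕ → ℕ) : SteinitzNum :=
  SteinitzNum.lcmSet (Set.range fun l => ∏ i ∈ Finset.range (l + 1), m i)

lemma St_apply (m : ℕ → ℕ) (p : Nat.Primes) :
    St m p = ⨆ l, ((MM m (l + 1)).factorization (p : ℕ) : ℕ∞) := by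
  simp only [St, SteinitzNum.lcmSet, iSup_range, MM]

lemma le_St {m : ℕ → ℕ} (hm : ∀ i, 2 ≤ m i) (p : Nat.Primes) (l : ℕ) :
    ((MM m l).factorization (p : ℕ) : ℕ∞) ≤ St m p := by
  rw [St_apply]
  refine le_trans ?_ (le_iSup _ l)
  have := (Nat.factorization_le_iff_dvd (MM_pos hm l).ne' (MM_pos hm (l+1)).ne').mpr
    (MM_dvd m (Nat.le_succ l))
  exact_mod_cast this (p : ℕ)

lemma le_of_dvd {m n : ℕ → ℕ} (hm : ∀ i, 2 ≤ m i) (hn : ∀ i, 2 ≤ n i) (k : ℕ) (hk : 0 < k)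
    (h : ∀ j, ∃ l, MM n j ∣ k * MM m l) (p : Nat.Primes) :
    St n p ≤ (k.factorization (p : ℕ) : ℕ∞) + St m p := by
  rw [St_apply]
  refine iSup_le fun j => ?_
  obtain ⟨l, hl⟩ := h (j + 1)
  have h1 := (Nat.factorization_le_iff_dvd (MM_pos hn _).ne'
    (Nat.mul_pos hk (MM_pos hm l)).ne').mpr hl (p : ℕ)
  rw [Nat.factorization_mul hk.ne' (MM_pos hm l).ne'] at h1
  refine le_trans ?_ (add_le_add_right (le_St hm p l) _)
  exact_mod_cast h1

lemma asymp_of_le (a b : SteinitzNum) (k k' : ℕ) (hk : 0 < k) (hk' : 0 < k')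
    (h : ∀ p : Nat.Primes, b p ≤ (k.factorization (p : ℕ) : ℕ∞) + a p)
    (h' : ∀ p : Nat.Primes, a p ≤ (k'.factorization (p : ℕ) : ℕ∞) + b p) : AsympEquiv a b := by
  classical
  let P := (k * k').primeFactors
  have hP : ∀ p ∈ P, p.Prime := fun p hp => Nat.prime_of_mem_primeFactors hp
  have main : ∀ e : Nat.Primes → ℕ, ∃ N : ℕ, 0 < N ∧ ∀ p : Nat.Primes,
      N.factorization p = if (p : ℕ) ∈ P then e p else 0 := by
    intro e
    let E : ℕ → ℕ := fun p => if hp : p.Prime then e ⟨p, hp⟩ else 0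
    refine ⟨∏ p ∈ P, p ^ E p, Finset.prod_pos fun p hp => pow_pos (hP p hp).pos _, fun p => ?_⟩
    rw [Nat.factorization_prod (fun q hq => (pow_pos (hP q hq).pos _).ne')]
    rw [Finsupp.finsetSum_apply]
    have : ∀ q ∈ P, (q ^ E q).factorization (p : ℕ) = if (p : ℕ) = q then e p else 0 := by
      intro q hq
      rw [(hP q hq).factorization_pow, Finsupp.single_apply]
      by_cases hpq : (p : ℕ) = q
      · subst hpq
        simp only [E, p.2, dif_pos, if_true]
        rfl
      · simp [hpq, Ne.symm hpq]
    rw [Finset.sum_congr rfl this, Finset.sum_ite_eq]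
  obtain ⟨N, hN, hN'⟩ := main fun p => (b p - a p).toNat
  obtain ⟨M, hM, hM'⟩ := main fun p => (a p - b p).toNat
  refine ⟨N, M, hN, hM, funext fun p => ?_⟩
  change ((N.factorization (p : ℕ) : ℕ) : ℕ∞) + a p = ((M.factorization (p : ℕ) : ℕ) : ℕ∞) + b p
  rw [hN', hM']
  have h1 := h p
  have h2 := h' p
  by_cases hp : (p : ℕ) ∈ P
  · simp only [hp, if_true]
    generalize a p = α at *
    generalize b p = β at *
    induction α using ENat.recTopCoe with
    | top =>
      induction β using ENat.recTopCoe with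
      | top => simp
      | coe β => exact absurd h2 (by rw [top_le_iff]; exact_mod_cast ENat.coe_ne_top _)
    | coe α =>
      induction β using ENat.recTopCoe with
      | top => exact absurd h1 (by rw [top_le_iff]; exact_mod_cast ENat.coe_ne_top _)
      | coe β =>
        rw [← ENat.coe_sub, ← ENat.coe_sub, ENat.toNat_coe, ENat.toNat_coe]
        norm_cast
        omega
  · simp only [hp, if_false]
    have hp' : ¬ (p : ℕ) ∣ k * k' := fun hd => hp (Nat.mem_primeFactors.mpr
      ⟨p.2, hd, (Nat.mul_pos hk hk').ne'⟩)
    rw [Nat.factorization_eq_zero_of_not_dvd (fun hd => hp' (hd.mul_right _))] at h1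
    rw [Nat.factorization_eq_zero_of_not_dvd (fun hd => hp' (hd.mul_left _))] at h2
    simp only [Nat.cast_zero, zero_add] at *
    exact le_antisymm h2 h1

lemma dvd_of_asymp {m n : ℕ → ℕ} (hm : ∀ i, 2 ≤ m i) (hn : ∀ i, 2 ≤ n i) (a b : ℕ)
    (ha : 0 < a) (hb : 0 < b) (h : ofNat a * St m = ofNat b * St n) (j : ℕ) :
    ∃ l, b * MM n j ∣ a * MM m l := by
  have hbn := (Nat.mul_pos hb (MM_pos hn j)).ne'
  have ev : ∀ p ∈ (b * MM n j).primeFactors, ∀ᶠ l in Filter.atTop,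
      (b * MM n j).factorization p ≤ (a * MM m l).factorization p := by
    intro p hp
    have hpp := Nat.prime_of_mem_primeFactors hp
    have h1 : (a.factorization p : ℕ∞) + St m ⟨p, hpp⟩ = b.factorization p + St n ⟨p, hpp⟩ :=
      congrFun h ⟨p, hpp⟩
    have h2 := le_St hn ⟨p, hpp⟩ j
    have h3 : (((b * MM n j).factorization p : ℕ) : ℕ∞) ≤
        ⨆ l, (((a * MM m (l + 1)).factorization p : ℕ) : ℕ∞) := by
      have : (⨆ l, (((a * MM m (l + 1)).factorization p : ℕ) : ℕ∞)) =
          a.factorization p + St m ⟨p, hpp⟩ := by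
        refine Eq.trans ?_ (congrArg (fun z : ℕ∞ => (a.factorization p : ℕ∞) + z)
          (St_apply m ⟨p, hpp⟩).symm)
        rw [ENat.add_iSup]
        refine iSup_congr fun l => ?_
        rw [Nat.factorization_mul ha.ne' (MM_pos hm _).ne']
        simp
      rw [this, h1, Nat.factorization_mul hb.ne' (MM_pos hn _).ne']
      rw [Finsupp.add_apply, Nat.cast_add]
      exact add_le_add_right h2 _
    have h4 : ∃ l, (b * MM n j).factorization p ≤ (a * MM m (l + 1)).factorization p := by
      by_contra! hcon
      have hpos : 0 < (b * MM n j).factorization p := lt_of_le_of_lt (Nat.zero_le _) (hcon 0)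
      have h5 : (⨆ l, (((a * MM m (l + 1)).factorization p : ℕ) : ℕ∞)) ≤
          (((b * MM n j).factorization p - 1 : ℕ) : ℕ∞) :=
        iSup_le fun l => by
          have := hcon l
          exact_mod_cast (by omega)
      have h6 := h3.trans h5
      norm_cast at h6
      omega
    obtain ⟨l, hl⟩ := h4
    filter_upwards [Filter.eventually_ge_atTop (l + 1)] with l' hl'
    refine hl.trans ?_
    exact (Nat.factorization_le_iff_dvd (Nat.mul_pos ha (MM_pos hm _)).ne'
      (Nat.mul_pos ha (MM_pos hm _)).ne').mpr (mul_dvd_mul_left a (MM_dvd m hl')) p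
  obtain ⟨l, hl⟩ := ((Filter.eventually_all_finset _).mpr ev).exists
  refine ⟨l, (Nat.factorization_le_iff_dvd hbn (Nat.mul_pos ha (MM_pos hm _)).ne').mp fun p => ?_⟩
  by_cases hp : p ∈ (b * MM n j).primeFactors
  · exact hl p hp
  · rw [← Nat.support_factorization, Finsupp.notMem_support_iff] at hp
    rw [hp]; exact Nat.zero_le _

/-- independence of the level -/
lemma indep {m : ℕ → ℕ} (hm : ∀ i, 2 ≤ m i) (x : oneSolenoid m) (a d : ℕ) (hd : 0 < d)
    (l l' c c' : ℕ) (h : a * MM m l = d * c) (h' : a * MM m l' = d * c') :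
    c • x.1 l = c' • x.1 l' := by
  obtain ⟨e, he⟩ := MM_dvd m (le_max_left l l')
  obtain ⟨e', he'⟩ := MM_dvd m (le_max_right l l')
  rw [coord hm x (le_max_left l l') e he, coord hm x (le_max_right l l') e' he', ← mul_smul,
    ← mul_smul]
  congr 1
  apply Nat.eq_of_mul_eq_mul_left hd
  rw [← mul_assoc, ← mul_assoc, ← h, ← h', mul_assoc, mul_assoc, ← he, ← he']

lemma exists_map {m n : ℕ → ℕ} (hm : ∀ i, 2 ≤ m i) (hn : ∀ i, 2 ≤ n i) (a b : ℕ) (hb : 0 < b)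
    (h : ∀ j, ∃ l, b * MM n j ∣ a * MM m l) :
    ∃ φ : C(oneSolenoid m, oneSolenoid n), ∀ x j l c, a * MM m l = b * MM n j * c →
      (φ x).1 j = c • x.1 l := by
  choose L C hC using h
  refine ⟨⟨fun x => ⟨fun j => C j • x.1 (L j), fun j => ?_⟩, ?_⟩, ?_⟩
  · rw [← mul_smul]
    refine indep hm x a (b * MM n j) (Nat.mul_pos hb (MM_pos hn j)) _ _ _ _ (hC j) ?_
    rw [hC (j + 1), MM_succ]
    ring
  · exact Continuous.subtype_mk (continuous_pi fun j => (continuous_coord (L j)).nsmul _) _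
  · intro x j l c hc
    exact indep hm x a (b * MM n j) (Nat.mul_pos hb (MM_pos hn j)) _ _ _ _ (hC j) hc

lemma comp_eq {m n : ℕ → ℕ} (hm : ∀ i, 2 ≤ m i) (hn : ∀ i, 2 ≤ n i) (a b : ℕ)
    (ha : 0 < a) (hb : 0 < b)
    (h : ∀ j, ∃ l, b * MM n j ∣ a * MM m l) (h' : ∀ j, ∃ l, a * MM m j ∣ b * MM n l)
    (φ : oneSolenoid m → oneSolenoid n) (ψ : oneSolenoid n → oneSolenoid m)
    (hφ : ∀ x j l c, a * MM m l = b * MM n j * c → (φ x).1 j = c • x.1 l)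
    (hψ : ∀ x j l c, b * MM n l = a * MM m j * c → (ψ x).1 j = c • x.1 l) (x : oneSolenoid m) :
    ψ (φ x) = x := by
  refine Subtype.ext (funext fun i => ?_)
  obtain ⟨j, c, hc⟩ := h' i
  obtain ⟨l, d, hd⟩ := h j
  rw [hψ _ i j c hc, hφ _ j l d hd, ← mul_smul]
  have := indep hm x a (a * MM m i) (Nat.mul_pos ha (MM_pos hm i)) l i (c * d) 1
    (by rw [hd, hc]; ring) (by ring)
  rw [this, one_smul]

end SolenoidProof

/-- Bing; McCord; Aarts–Fokkink. Two one-dimensional solenoids are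
homeomorphic if and only if their Steinitz orders are asymptotically equivalent. -/
theorem oneSolenoid_homeomorphic_iff_asympEquiv (m n : ℕ → ℕ)
    (hm : ∀ i, 2 ≤ m i) (hn : ∀ i, 2 ≤ n i) :
    Nonempty (oneSolenoid m ≃ₜ oneSolenoid n) ↔
      SteinitzNum.AsympEquiv
        (SteinitzNum.lcmSet (Set.range fun ℓ => ∏ i ∈ Finset.range (ℓ + 1), m i))
        (SteinitzNum.lcmSet (Set.range fun ℓ => ∏ i ∈ Finset.range (ℓ + 1), n i)) := by
  constructor
  · rintro ⟨h⟩
    obtain ⟨k, hk, h1⟩ := SolenoidProof.dvd_of_homeo hm hn h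
    obtain ⟨k', hk', h2⟩ := SolenoidProof.dvd_of_homeo hn hm h.symm
    exact SolenoidProof.asymp_of_le _ _ k k' hk hk'
      (SolenoidProof.le_of_dvd hm hn k hk h1) (SolenoidProof.le_of_dvd hn hm k' hk' h2)
  · rintro ⟨a, b, ha, hb, h⟩
    have h1 := SolenoidProof.dvd_of_asymp hm hn a b ha hb h
    have h2 := SolenoidProof.dvd_of_asymp hn hm b a hb ha h.symm
    obtain ⟨φ, hφ⟩ := SolenoidProof.exists_map hm hn a b hb h1
    obtain ⟨ψ, hψ⟩ := SolenoidProof.exists_map hn hm b a ha h2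
    exact ⟨{ toFun := φ
             invFun := ψ
             left_inv := SolenoidProof.comp_eq hm hn a b ha hb h1 h2 φ ψ hφ hψ
             right_inv := SolenoidProof.comp_eq hn hm b a hb ha h2 h1 ψ φ hψ hφ
             continuous_toFun := φ.continuous
             continuous_invFun := ψ.continuous }⟩
end
end

section
/- Let P = { q_ℓ : M_ℓ → M_{ℓ−1} : ℓ ≥ 1 } and P' = { q'_ℓ : M'_ℓ → M'_{ℓ−1} : ℓ ≥ 1 } be presentations, i.e. each M_ℓ and M'_ℓ is a compact connected topological manifold without boundary and each q_ℓ (resp. q'_ℓ) is a covering map of finite degree m_ℓ > 1 (resp. m'_ℓ > 1). Let S_P ⊂ ∏_{ℓ≥0} M_ℓ be the inverse limit space of the tower P, and likewise S_{P'}. If S_P and S_{P'} are homeomorphic, then the Steinitz orders Π[P] = LCM{ m₁m₂⋯m_ℓ : ℓ ≥ 1 } and Π[P'] = LCM{ m'₁m'₂⋯m'_ℓ : ℓ ≥ 1 } are asymptotically equivalent. -/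
noncomputable section

open Set Topology

set_option linter.unusedSectionVars false

/-- Abstract data of a solenoid `S` over the base `X`, with levels `M k`. -/
structure Tow (S X : Type) [MetricSpace S] [MetricSpace X]
    (M : ℕ → Type) [∀ k, TopologicalSpace (M k)] where
  p : ∀ k, S → M k
  r : ∀ k, M k → X
  pr : S → X
  D : ℕ → ℕ
  p_cont : ∀ k, Continuous (p k)
  p_surj : ∀ k, Function.Surjective (p k)
  r_inj : ∀ k, IsLocallyInjective (r k)
  r_fin : ∀ k b, ((r k) ⁻¹' {b}).Finite
  pr_cont : Continuous pr
  rp : ∀ k x, r k (p k x) = pr x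
  p_mono : ∀ k x y, p (k + 1) x = p (k + 1) y → p k x = p k y
  p_sep : ∀ x y, (∀ k, p k x = p k y) → x = y
  D_pos : ∀ k, 0 < D k
  D_count : ∀ k m, k ≤ m → ∀ e, (p m '' (p k ⁻¹' {e})).ncard * D k = D m
  e0 : ℝ
  e0_pos : 0 < e0
  lift : ∀ Q : Set X, IsPreconnected Q → (∀ a ∈ Q, ∀ b ∈ Q, dist a b < e0) →
    ∀ x, pr x ∈ Q → ∃ s : X → S, ContinuousOn s Q ∧ (∀ b ∈ Q, pr (s b) = b) ∧ s (pr x) = x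
  loc : ∀ ε > 0, ∃ δ > 0, ∀ a b : X, dist a b < δ → ∃ Q : Set X, IsPreconnected Q ∧ a ∈ Q ∧
    b ∈ Q ∧ ∀ a ∈ Q, ∀ b ∈ Q, dist a b < ε

namespace Tow

variable {S X : Type} [MetricSpace S] [MetricSpace X] {M : ℕ → Type}
  [∀ k, TopologicalSpace (M k)] (W : Tow S X M)

/-- `x` and `y` lie in a connected set whose projection to the base is `ε`-small. -/
def Near (ε : ℝ) (x y : S) : Prop :=
  ∃ C : Set S, IsPreconnected C ∧ x ∈ C ∧ y ∈ C ∧ ∀ a ∈ C, ∀ b ∈ C, dist (W.pr a) (W.pr b) < ε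

theorem Near.symm {W : Tow S X M} {ε : ℝ} {x y : S} (h : W.Near ε x y) : W.Near ε y x := by
  obtain ⟨C, h1, h2, h3, h4⟩ := h
  exact ⟨C, h1, h3, h2, h4⟩

theorem Near.mono {W : Tow S X M} {ε δ : ℝ} {x y : S} (h : W.Near ε x y) (hε : ε ≤ δ) :
    W.Near δ x y := by
  obtain ⟨C, h1, h2, h3, h4⟩ := h
  exact ⟨C, h1, h2, h3, fun a ha b hb => (h4 a ha b hb).trans_le hε⟩

theorem near_refl {ε : ℝ} (hε : 0 < ε) (x : S) : W.Near ε x x :=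
  ⟨{x}, isPreconnected_singleton, rfl, rfl, by rintro a rfl b rfl; simpa using hε⟩

theorem Near.trans {W : Tow S X M} {ε δ : ℝ} {x y z : S} (h : W.Near ε x y)
    (h' : W.Near δ y z) : W.Near (ε + δ) x z := by
  obtain ⟨C, h1, h2, h3, h4⟩ := h
  obtain ⟨C', h1', h2', h3', h4'⟩ := h'
  have e1 := h4 y h3 y h3
  have e2 := h4' y h2' y h2'
  rw [dist_self] at e1 e2
  refine ⟨C ∪ C', IsPreconnected.union y h3 h2' h1 h1', Or.inl h2, Or.inr h3', ?_⟩
  rintro a (ha | ha) b (hb | hb)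
  · linarith [h4 a ha b hb]
  · linarith [h4 a ha y h3, h4' y h2' b hb, dist_triangle (W.pr a) (W.pr y) (W.pr b)]
  · linarith [h4' a ha y h2', h4 y h3 b hb, dist_triangle (W.pr a) (W.pr y) (W.pr b)]
  · linarith [h4' a ha b hb]

theorem p_mono' {k m : ℕ} (hkm : k ≤ m) {x y : S} (h : W.p m x = W.p m y) :
    W.p k x = W.p k y := by
  induction m, hkm using Nat.le_induction with
  | base => exact h
  | succ m _ ih => exact ih (W.p_mono _ _ _ h)

theorem pr_eq {k : ℕ} {x y : S} (h : W.p k x = W.p k y) : W.pr x = W.pr y := by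
  rw [← W.rp k x, ← W.rp k y, h]

variable [∀ k, T2Space (M k)]

/-- Transport along plaques, exact version. -/
theorem transport {C : Set S} (hC : IsPreconnected C)
    (hd : ∀ a ∈ C, ∀ b ∈ C, dist (W.pr a) (W.pr b) < W.e0) {x x2 : S} (hx : x ∈ C)
    (hpr : W.pr x2 = W.pr x) :
    ∃ s : X → S, ContinuousOn s (W.pr '' C) ∧ (∀ b ∈ W.pr '' C, W.pr (s b) = b) ∧
      s (W.pr x) = x2 ∧
      ∀ m, W.p m x2 = W.p m x → ∀ c ∈ C, W.p m (s (W.pr c)) = W.p m c := by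
  obtain ⟨s, hs, hs1, hs2⟩ := W.lift (W.pr '' C) (hC.image _ W.pr_cont.continuousOn)
    (by rintro _ ⟨a, ha, rfl⟩ _ ⟨b, hb, rfl⟩; exact hd a ha b hb) x2 (hpr ▸ ⟨x, hx, rfl⟩)
  refine ⟨s, hs, hs1, hpr ▸ hs2, fun m hm => ?_⟩
  have hco : ContinuousOn (fun c => s (W.pr c)) C :=
    hs.comp W.pr_cont.continuousOn (fun c hc => ⟨c, hc, rfl⟩)
  refine IsSeparatedMap.eqOn_of_comp_eqOn (T2Space.isSeparatedMap (W.r m)) (W.r_inj m) hC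
    ((W.p_cont m).comp_continuousOn hco) (W.p_cont m).continuousOn ?_ hx ?_
  · intro c hc
    simp only [Function.comp, W.rp]
    exact hs1 _ ⟨c, hc, rfl⟩
  · rw [← hpr, hs2, hm]

theorem near_transport {ε : ℝ} (hε : ε ≤ W.e0) {x y x2 : S} (h : W.Near ε x y) {m : ℕ}
    (hm : W.p m x2 = W.p m x) : ∃ y2, W.p m y2 = W.p m y ∧ W.Near ε x2 y2 := by
  obtain ⟨C, h1, h2, h3, h4⟩ := h
  obtain ⟨s, hs, hs1, hs2, hs3⟩ := W.transport h1
    (fun a ha b hb => (h4 a ha b hb).trans_le hε) h2 (W.pr_eq hm)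
  refine ⟨s (W.pr y), hs3 m hm y h3, s '' (W.pr '' C),
    (h1.image _ W.pr_cont.continuousOn).image _ hs, ⟨_, ⟨x, h2, rfl⟩, hs2⟩,
    ⟨_, ⟨y, h3, rfl⟩, rfl⟩, ?_⟩
  rintro _ ⟨_, ⟨a, ha, rfl⟩, rfl⟩ _ ⟨_, ⟨b, hb, rfl⟩, rfl⟩
  rw [hs1 _ ⟨a, ha, rfl⟩, hs1 _ ⟨b, hb, rfl⟩]
  exact h4 a ha b hb

theorem near_eq {ε : ℝ} (hε : ε ≤ W.e0) {x y : S} (h : W.Near ε x y)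
    (hp : W.pr x = W.pr y) : x = y := by
  obtain ⟨C, h1, h2, h3, h4⟩ := h
  obtain ⟨s, hs, hs1, hs2, hs3⟩ := W.transport h1
    (fun a ha b hb => (h4 a ha b hb).trans_le hε) h2 rfl
  refine W.p_sep _ _ fun m => ?_
  rw [← hs3 m rfl y h3, ← hp, hs2]

theorem exists_near_base {ε : ℝ} (hε : 0 < ε) : ∃ δ > 0, ∀ (y : S) (b : X),
    dist (W.pr y) b < δ → ∃ y', W.pr y' = b ∧ W.Near ε y' y := by
  obtain ⟨δ, hδ, h⟩ := W.loc (min ε W.e0) (lt_min hε W.e0_pos)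
  refine ⟨δ, hδ, fun y b hb => ?_⟩
  obtain ⟨Q, hQ, hy, hbQ, hd⟩ := h _ _ hb
  obtain ⟨s, hs, hs1, hs2⟩ := W.lift Q hQ
    (fun a ha b hb => (hd a ha b hb).trans_le (min_le_right _ _)) y hy
  refine ⟨s b, hs1 b hbQ, s '' Q, hQ.image _ hs, ⟨b, hbQ, rfl⟩, ⟨_, hy, hs2⟩, ?_⟩
  rintro _ ⟨a, ha, rfl⟩ _ ⟨c, hc, rfl⟩
  rw [hs1 a ha, hs1 c hc]
  exact (hd a ha c hc).trans_le (min_le_left _ _)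

variable [CompactSpace S]

theorem small_fiber {ε : ℝ} (hε : 0 < ε) : ∃ K, ∀ k ≥ K, ∀ x y, W.p k x = W.p k y →
    dist x y < ε := by
  by_contra hcon
  push Not at hcon
  let t : ℕ → Set (S × S) := fun k => {z | W.p k z.1 = W.p k z.2 ∧ ε ≤ dist z.1 z.2}
  have hne := IsCompact.nonempty_iInter_of_sequence_nonempty_isCompact_isClosed t
    (fun k z hz => ⟨W.p_mono _ _ _ hz.1, hz.2⟩)
    (fun k => by
      obtain ⟨k', hk', x, y, hxy, hd⟩ := hcon k
      exact ⟨(x, y), W.p_mono' hk' hxy, hd⟩)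
    ?_ ?_
  · obtain ⟨z, hz⟩ := hne
    have hz' := fun k => Set.mem_iInter.1 hz k
    have : z.1 = z.2 := W.p_sep _ _ fun k => (hz' k).1
    have h2 := (hz' 0).2
    rw [this, dist_self] at h2
    linarith
  · refine IsClosed.isCompact ?_
    exact (isClosed_eq ((W.p_cont 0).comp continuous_fst) ((W.p_cont 0).comp continuous_snd)).inter
      (isClosed_le continuous_const (continuous_fst.dist continuous_snd))
  · intro k
    exact (isClosed_eq ((W.p_cont k).comp continuous_fst) ((W.p_cont k).comp continuous_snd)).inter
      (isClosed_le continuous_const (continuous_fst.dist continuous_snd))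

theorem small_plaque [CompactSpace X] {ε : ℝ} (hε : 0 < ε) : ∃ δ > 0, ∀ C : Set S,
    IsPreconnected C →
    (∀ a ∈ C, ∀ b ∈ C, dist (W.pr a) (W.pr b) < δ) → ∀ a ∈ C, ∀ b ∈ C, dist a b < ε := by
  obtain ⟨K, hK⟩ := W.small_fiber (half_pos hε)
  have hV : ∀ b : X, ∃ V : Set X, IsOpen V ∧ b ∈ V ∧ ∀ C : Set S, IsPreconnected C →
      (∀ a ∈ C, W.pr a ∈ V) → ∀ a ∈ C, ∀ b ∈ C, dist a b < ε := by
    intro b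
    obtain ⟨U, hU, hdisj⟩ := (W.r_fin K b).t2_separation
    choose g hg using W.p_surj K
    let N : M K → Set S := fun e => W.p K ⁻¹' U e ∩ Metric.ball (g e) (ε / 2)
    have hNo : ∀ e, IsOpen (N e) := fun e =>
      ((hU e).2.preimage (W.p_cont K)).inter Metric.isOpen_ball
    have hcl : IsClosedMap W.pr := W.pr_cont.isClosedMap
    refine ⟨Set.kernImage W.pr (⋃ e ∈ W.r K ⁻¹' {b}, N e),
      isClosedMap_iff_kernImage.1 hcl (isOpen_biUnion fun e _ => hNo e), ?_, ?_⟩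
    · intro x hx
      refine Set.mem_biUnion (x := W.p K x) (by simp [W.rp, hx]) ⟨(hU _).1, ?_⟩
      exact hK K le_rfl _ _ (hg _).symm
    · intro C hC hCV a ha a' ha'
      have hsub : ∀ c ∈ C, ∃ e ∈ W.r K ⁻¹' {b}, c ∈ N e := by
        intro c hc
        have := hCV c hc (x := c) rfl
        simpa only [Set.mem_iUnion, exists_prop] using this
      obtain ⟨e, he, hae⟩ := hsub a ha
      have : C ⊆ N e := by
        refine hC.subset_left_of_subset_union (v := ⋃ e' ∈ W.r K ⁻¹' {b} \ {e}, N e') (hNo e)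
          (isOpen_biUnion fun e _ => hNo e) ?_ ?_ ⟨a, ha, hae⟩
        · refine Set.disjoint_iUnion₂_right.2 fun e' he' => ?_
          have := hdisj he he'.1 (fun h => he'.2 h.symm)
          exact ((this.preimage (W.p K)).mono Set.inter_subset_left Set.inter_subset_left)
        · intro c hc
          obtain ⟨e', he', hce'⟩ := hsub c hc
          by_cases h : e' = e
          · left; exact h ▸ hce'
          · right; exact Set.mem_biUnion (x := e') ⟨he', h⟩ hce'
      have h1 := (this ha).2
      have h2 := (this ha').2
      rw [Metric.mem_ball] at h1 h2
      linarith [dist_triangle_right a a' (g e)]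
  choose V hVo hVb hVC using hV
  obtain ⟨δ, hδ, h⟩ := lebesgue_number_lemma_of_metric (s := Set.univ) isCompact_univ hVo
    (fun b _ => Set.mem_iUnion.2 ⟨b, hVb b⟩)
  refine ⟨δ, hδ, fun C hC hd a ha b hb => ?_⟩
  obtain ⟨i, hi⟩ := h (W.pr a) trivial
  exact hVC i C hC (fun c hc => hi (hd c hc a ha)) a ha b hb

theorem sep_fiber (m : ℕ) : ∃ η > 0, ∀ x y, dist x y < η → W.pr x = W.pr y →
    W.p m x = W.p m y := by
  have h := fun e => W.r_inj m e
  choose U hUo hUe hU using h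
  obtain ⟨δ, hδ, h⟩ := lebesgue_number_lemma_of_metric (s := (Set.univ : Set S)) isCompact_univ
    (c := fun e => W.p m ⁻¹' U e) (fun e => (hUo e).preimage (W.p_cont m))
    (fun x _ => Set.mem_iUnion.2 ⟨W.p m x, hUe _⟩)
  refine ⟨δ, hδ, fun x y hxy hp => ?_⟩
  obtain ⟨i, hi⟩ := h y trivial
  exact hU i (hi hxy) (hi (Metric.mem_ball_self hδ)) (by rw [W.rp, W.rp, hp])

theorem exists_near [CompactSpace X] {ε : ℝ} (hε : 0 < ε) (m : ℕ) : ∃ δ > 0, ∀ x y : S,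
    dist x y < δ → ∃ y', W.p m y' = W.p m x ∧ W.Near ε y' y := by
  obtain ⟨η, hη, h1⟩ := W.sep_fiber m
  obtain ⟨τ, hτ, h2⟩ := W.small_plaque (half_pos hη)
  obtain ⟨δ, hδ, h3⟩ := W.exists_near_base (lt_min hε hτ)
  have huc : UniformContinuous W.pr := CompactSpace.uniformContinuous_of_continuous W.pr_cont
  obtain ⟨δ', hδ', h4⟩ := Metric.uniformContinuous_iff.1 huc δ hδ
  refine ⟨min δ' (η / 2), lt_min hδ' (half_pos hη), fun x y hxy => ?_⟩
  obtain ⟨y', hy', hn⟩ := h3 y (W.pr x)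
    (by rw [dist_comm]; exact h4 (hxy.trans_le (min_le_left _ _)))
  refine ⟨y', h1 _ _ ?_ hy', hn.mono (min_le_left _ _)⟩
  obtain ⟨C, hC, c1, c2, c3⟩ := hn
  have := h2 C hC (fun a ha b hb => (c3 a ha b hb).trans_le (min_le_right _ _)) y' c1 y c2
  linarith [dist_triangle_right y' x y, hxy.trans_le (min_le_right _ _)]

variable {S' X' : Type} [MetricSpace S'] [MetricSpace X'] {M' : ℕ → Type}
  [∀ k, TopologicalSpace (M' k)] (W' : Tow S' X' M')

theorem near_map [CompactSpace X] {f : S → S'} (hf : Continuous f) {ε : ℝ}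
    (hε : 0 < ε) : ∃ δ > 0, ∀ x y, W.Near δ x y → W'.Near ε (f x) (f y) := by
  have huc : UniformContinuous (W'.pr ∘ f) :=
    CompactSpace.uniformContinuous_of_continuous (W'.pr_cont.comp hf)
  obtain ⟨δ', hδ', h4⟩ := Metric.uniformContinuous_iff.1 huc ε hε
  obtain ⟨τ, hτ, h2⟩ := W.small_plaque hδ'
  refine ⟨τ, hτ, ?_⟩
  rintro x y ⟨C, hC, c1, c2, c3⟩
  refine ⟨f '' C, hC.image _ hf.continuousOn, ⟨x, c1, rfl⟩, ⟨y, c2, rfl⟩, ?_⟩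
  rintro _ ⟨a, ha, rfl⟩ _ ⟨b, hb, rfl⟩
  exact h4 (h2 C hC c3 a ha b hb)

end Tow

/-- A bi-total, bi-unique relation between two sets gives equality of cardinalities. -/
theorem ncard_eq_of_rel {α β : Type} {A : Set α} {B : Set β} (R : α → β → Prop)
    (h1 : ∀ a ∈ A, ∃ b ∈ B, R a b) (h2 : ∀ b ∈ B, ∃ a ∈ A, R a b)
    (h3 : ∀ a ∈ A, ∀ b ∈ B, ∀ b' ∈ B, R a b → R a b' → b = b')
    (h4 : ∀ a ∈ A, ∀ a' ∈ A, ∀ b ∈ B, R a b → R a' b → a = a') : A.ncard = B.ncard := by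
  choose f hf hR using h1
  refine Set.ncard_congr f hf ?_ ?_
  · intro a a' ha ha' heq
    exact h4 a ha a' ha' (f a ha) (hf a ha) (hR a ha) (heq ▸ hR a' ha')
  · intro b hb
    obtain ⟨a, ha, hab⟩ := h2 b hb
    exact ⟨a, ha, h3 a ha _ (hf a ha) b hb (hR a ha) hab⟩

/-- Cardinality of a finite disjoint union of sets of the same cardinality. -/
theorem ncard_disjoint_union {α β : Type} {I : Set α} (hI : I.Finite) (U : α → Set β) (n : ℕ)
    (hU : ∀ i ∈ I, (U i).Finite) (hn : ∀ i ∈ I, (U i).ncard = n)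
    (hd : ∀ i ∈ I, ∀ j ∈ I, ∀ z, z ∈ U i → z ∈ U j → i = j) :
    (⋃ i ∈ I, U i).ncard = I.ncard * n := by
  rw [Set.Finite.ncard_biUnion hI hU, finsum_mem_congr rfl hn, finsum_mem_eq_finite_toFinset_sum _ hI,
    Finset.sum_const, smul_eq_mul, Set.ncard_eq_toFinset_card _ hI]
  intro i hi j hj hij
  exact Set.disjoint_left.2 fun z hz hz' => hij (hd i hi j hj z hz hz')

namespace Tow

variable {S X : Type} [MetricSpace S] [MetricSpace X] {M : ℕ → Type}
  [∀ k, TopologicalSpace (M k)] [∀ k, T2Space (M k)] (W : Tow S X M)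

theorem image_finite (k : ℕ) (T : Set S) (b : X) (hT : ∀ z ∈ T, W.pr z = b) :
    (W.p k '' T).Finite := by
  refine (W.r_fin k b).subset ?_
  rintro _ ⟨z, hz, rfl⟩
  simp [W.rp, hT z hz]

theorem near_key {s : ℝ} (hs : s + s ≤ W.e0) {k : ℕ} {z z1 z2 z3 : S} (h : W.Near s z z2)
    (h' : W.Near s z1 z3) (hp : W.p k z = W.p k z1) (hb : W.pr z2 = W.pr z3) :
    W.p k z2 = W.p k z3 := by
  have hs0 : s ≤ W.e0 := by
    obtain ⟨C, _, c1, _, c3⟩ := h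
    have := c3 _ c1 _ c1
    rw [dist_self] at this
    linarith
  obtain ⟨y, hy, hn⟩ := W.near_transport hs0 h hp.symm
  have : y = z3 := W.near_eq hs (hn.symm.trans h') ((W.pr_eq hy).trans hb)
  rw [← hy, this]

/-- Comparison of level-`k` counts of two transversal sets matched along plaques. -/
theorem ncard_compare {s : ℝ} (hs : s + s ≤ W.e0) (k : ℕ) {T T2 : Set S} {b b2 : X}
    (hT : ∀ z ∈ T, W.pr z = b) (hT2 : ∀ z ∈ T2, W.pr z = b2)
    (h1 : ∀ z ∈ T, ∃ z2 ∈ T2, W.Near s z z2) (h2 : ∀ z2 ∈ T2, ∃ z ∈ T, W.Near s z z2) :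
    (W.p k '' T).ncard = (W.p k '' T2).ncard := by
  refine ncard_eq_of_rel (fun a c => ∃ z ∈ T, ∃ z2 ∈ T2, W.p k z = a ∧ W.p k z2 = c ∧ W.Near s z z2)
    ?_ ?_ ?_ ?_
  · rintro _ ⟨z, hz, rfl⟩
    obtain ⟨z2, hz2, hn⟩ := h1 z hz
    exact ⟨_, ⟨z2, hz2, rfl⟩, z, hz, z2, hz2, rfl, rfl, hn⟩
  · rintro _ ⟨z2, hz2, rfl⟩
    obtain ⟨z, hz, hn⟩ := h2 z2 hz2
    exact ⟨_, ⟨z, hz, rfl⟩, z, hz, z2, hz2, rfl, rfl, hn⟩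
  · rintro a - c - c' - ⟨z, hz, z2, hz2, rfl, rfl, hn⟩ ⟨y, hy, y2, hy2, hzy, rfl, hn'⟩
    exact W.near_key hs hn hn' hzy.symm ((hT2 _ hz2).trans (hT2 _ hy2).symm)
  · rintro a - a' - c - ⟨z, hz, z2, hz2, rfl, rfl, hn⟩ ⟨y, hy, y2, hy2, rfl, hzy, hn'⟩
    exact W.near_key hs hn.symm hn'.symm hzy.symm ((hT _ hz).trans (hT _ hy).symm)

/-- Count of a saturated set at deeper levels. -/
theorem ncard_saturated [Nonempty S] {k0 k : ℕ} (hk : k0 ≤ k) {T : Set S} {b : X}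
    (hT : ∀ z ∈ T, W.pr z = b) (hsat : ∀ z ∈ T, ∀ z', W.p k0 z' = W.p k0 z → z' ∈ T) :
    (W.p k '' T).ncard * W.D k0 = (W.p k0 '' T).ncard * W.D k := by
  have hD : ∀ e, (W.p k '' (W.p k0 ⁻¹' {e})).ncard = W.D k / W.D k0 := fun e => by
    rw [← W.D_count k0 k hk e, Nat.mul_div_cancel _ (W.D_pos k0)]
  have hdiv : W.D k / W.D k0 * W.D k0 = W.D k := by
    obtain ⟨x⟩ := ‹Nonempty S›
    rw [← hD (W.p k0 x), W.D_count k0 k hk]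
  have hU : W.p k '' T = ⋃ e ∈ W.p k0 '' T, W.p k '' (W.p k0 ⁻¹' {e}) := by
    ext y
    simp only [Set.mem_iUnion]
    constructor
    · rintro ⟨z, hz, rfl⟩
      exact ⟨W.p k0 z, ⟨z, hz, rfl⟩, z, rfl, rfl⟩
    · rintro ⟨_, ⟨z, hz, rfl⟩, z', hz', rfl⟩
      exact ⟨z', hsat z hz z' hz', rfl⟩
  rw [hU, ncard_disjoint_union (W.image_finite k0 T b hT) _ (W.D k / W.D k0) _ (fun e _ => hD e),
    mul_assoc, hdiv]
  · rintro i - j - z ⟨a, rfl, rfl⟩ ⟨a', rfl, h⟩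
    exact (W.p_mono' hk h).symm
  · rintro _ ⟨z, hz, rfl⟩
    exact W.image_finite k _ b (fun z' hz' => hT z' (hsat z hz z' hz'))

variable [CompactSpace S] {S' X' : Type} [MetricSpace S'] [MetricSpace X'] {M' : ℕ → Type}
  [∀ k, TopologicalSpace (M' k)] [∀ k, T2Space (M' k)] (W' : Tow S' X' M')

theorem const_of_local (m : ℕ) [ConnectedSpace (M m)] (c : S → ℕ)
    (hc : ∃ δ > 0, ∀ x x', dist x x' < δ → c x = c x')
    (hf : ∀ x y, W.p m x = W.p m y → c x = c y) (x y : S) : c x = c y := by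
  obtain ⟨δ, hδ, hc⟩ := hc
  have hcc : Continuous c := by
    refine continuous_iff_continuousAt.2 fun x => ?_
    refine ContinuousAt.congr (f := fun _ => c x) continuousAt_const ?_
    filter_upwards [Metric.ball_mem_nhds x hδ] with y hy
    exact hc x y (by rwa [dist_comm])
  have hq : IsQuotientMap (W.p m) :=
    (W.p_cont m).isClosedMap.isQuotientMap (W.p_cont m) (W.p_surj m)
  choose g hg using W.p_surj m
  have hgc : (fun e => c (g e)) ∘ W.p m = c := funext fun x => hf _ _ (hg _)
  have hg2 : Continuous fun e => c (g e) := hq.continuous_iff.2 (by rw [hgc]; exact hcc)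
  have := PreconnectedSpace.constant inferInstance hg2 (x := W.p m x) (y := W.p m y)
  rw [← congrFun hgc x, ← congrFun hgc y]
  exact this

/-- The transversal over the base point of `h x` hit by the cell `e`. -/
def Tr (h : S → S') (r : ℝ) (m : ℕ) (x : S) (e : M m) : Set S' :=
  {z | W'.pr z = W'.pr (h x) ∧ ∃ w, W.p m w = e ∧ W'.Near r z (h w)}

theorem dvd_main [CompactSpace X] [CompactSpace S'] [CompactSpace X'] [Nonempty S]
    [∀ k, ConnectedSpace (M k)] (h : S ≃ₜ S') :
    ∃ A > 0, ∀ m, ∃ k, W.D m ∣ A * W'.D k := by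
  -- choice of scales
  obtain ⟨r1, hr1, hinj⟩ := W'.near_map W h.symm.continuous W.e0_pos
  obtain ⟨r, hr, hr6, hr2⟩ : ∃ r > 0, (r + r + r) + (r + r + r) ≤ W'.e0 ∧ r + r ≤ r1 :=
    ⟨min (W'.e0 / 6) (r1 / 2), lt_min (by linarith [W'.e0_pos]) (by linarith),
      by linarith [min_le_left (W'.e0 / 6) (r1 / 2)],
      by linarith [min_le_right (W'.e0 / 6) (r1 / 2)]⟩
  obtain ⟨δ, hδ, hbase⟩ := W'.exists_near_base hr
  obtain ⟨τ, hτ, hmap⟩ := W.near_map W' h.continuous hr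
  have huc : UniformContinuous (fun x => W'.pr (h x)) :=
    CompactSpace.uniformContinuous_of_continuous (W'.pr_cont.comp h.continuous)
  obtain ⟨δ2, hδ2, hδ2'⟩ := Metric.uniformContinuous_iff.1 huc δ hδ
  obtain ⟨l, hl⟩ := W.small_fiber hδ2
  have hex : ∀ x w, W.p l w = W.p l x → ∃ z, W'.pr z = W'.pr (h x) ∧ W'.Near r z (h w) :=
    fun x w hw => hbase (h w) (W'.pr (h x)) (hδ2' (hl l le_rfl _ _ hw))
  have hsuc : UniformContinuous h.symm :=
    CompactSpace.uniformContinuous_of_continuous h.symm.continuous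
  let T : ∀ m, S → M m → Set S' := fun m x e => W.Tr W' h r m x e
  -- saturation
  have hsat : ∀ m ≥ l, ∃ k0, ∀ k ≥ k0, ∀ x e, (∀ w, W.p m w = e → W.p l w = W.p l x) →
      ∀ z ∈ T m x e, ∀ z', W'.p k z' = W'.p k z → z' ∈ T m x e := by
    intro m hm
    obtain ⟨δ3, hδ3, hB⟩ := W.exists_near hτ m
    obtain ⟨δ4, hδ4, hδ4'⟩ := Metric.uniformContinuous_iff.1 hsuc δ3 hδ3
    obtain ⟨k0, hk0⟩ := W'.small_fiber hδ4
    refine ⟨k0, fun k hk x e hxe z ⟨hz, w, hw, hn⟩ z' hz' => ?_⟩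
    obtain ⟨u, hu, hun⟩ := W'.near_transport (by linarith) hn hz'
    have hd : dist w (h.symm u) < δ3 := by
      have := hδ4' (hk0 k hk _ _ hu.symm)
      simpa using this
    obtain ⟨w2, hw2, hw2n⟩ := hB w (h.symm u) hd
    have hw2n' := hmap _ _ hw2n
    rw [h.apply_symm_apply] at hw2n'
    have hw2e : W.p m w2 = e := hw2.trans hw
    obtain ⟨z3, hz3, hz3n⟩ := hex x w2 (hxe w2 hw2e)
    have hz'b : W'.pr z' = W'.pr (h x) := (W'.pr_eq hz').trans hz
    have : z3 = z' := W'.near_eq (by linarith) ((hz3n.trans hw2n').trans hun.symm)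
      (hz3.trans hz'b.symm)
    subst this
    exact ⟨hz'b, w2, hw2e, hz3n⟩
  -- comparison
  have hcmp : ∀ m k x e x' e', (∀ w, W.p m w = e → W.p l w = W.p l x) →
      (∀ w, W.p m w = e' → W.p l w = W.p l x') →
      (∀ w, W.p m w = e → ∃ w', W.p m w' = e' ∧ W'.Near r (h w) (h w')) →
      (∀ w', W.p m w' = e' → ∃ w, W.p m w = e ∧ W'.Near r (h w) (h w')) →
      (W'.p k '' T m x e).ncard = (W'.p k '' T m x' e').ncard := by
    intro m k x e x' e' hxe hxe' h1 h2
    refine W'.ncard_compare hr6 k (fun z hz => hz.1) (fun z hz => hz.1) ?_ ?_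
    · rintro z ⟨hz, w, hw, hn⟩
      obtain ⟨w', hw', hn'⟩ := h1 w hw
      obtain ⟨z', hz', hzn'⟩ := hex x' w' (hxe' w' hw')
      exact ⟨z', ⟨hz', w', hw', hzn'⟩, (hn.trans hn').trans hzn'.symm⟩
    · rintro z ⟨hz, w, hw, hn⟩
      obtain ⟨w', hw', hn'⟩ := h2 w hw
      obtain ⟨z', hz', hzn'⟩ := hex x w' (hxe w' hw')
      exact ⟨z', ⟨hz', w', hw', hzn'⟩, (hzn'.trans hn').trans hn.symm⟩
  -- constancy
  have hconst : ∀ m ≥ l, ∀ k x y, (W'.p k '' T m x (W.p m x)).ncard =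
      (W'.p k '' T m y (W.p m y)).ncard := by
    intro m hm k
    refine W.const_of_local m (fun x => (W'.p k '' T m x (W.p m x)).ncard) ?_ ?_
    · have hτ' : 0 < min τ W.e0 := lt_min hτ W.e0_pos
      obtain ⟨δ3, hδ3, hB⟩ := W.exists_near hτ' m
      refine ⟨δ3, hδ3, fun x x' hxx' => ?_⟩
      obtain ⟨y, hy, hyn⟩ := hB x x' hxx'
      refine hcmp m k _ _ _ _ (fun w hw => W.p_mono' hm hw) (fun w hw => W.p_mono' hm hw) ?_ ?_
      · intro w hw
        obtain ⟨w', hw', hwn⟩ := W.near_transport (min_le_right _ _) hyn (hw.trans hy.symm)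
        exact ⟨w', hw', hmap _ _ (hwn.mono (min_le_left _ _))⟩
      · intro w' hw'
        obtain ⟨w, hw, hwn⟩ := W.near_transport (min_le_right _ _) hyn.symm hw'
        exact ⟨w, hw.trans hy, hmap _ _ (hwn.symm.mono (min_le_left _ _))⟩
    · intro x y hxy
      refine hcmp m k _ _ _ _ (fun w hw => W.p_mono' hm hw) (fun w hw => W.p_mono' hm hw) ?_ ?_
      · exact fun w hw => ⟨w, hw.trans hxy, W'.near_refl hr _⟩
      · exact fun w hw => ⟨w, hw.trans hxy.symm, W'.near_refl hr _⟩
  -- counting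
  have : Nonempty S' := ‹Nonempty S›.map h
  obtain ⟨x⟩ := ‹Nonempty S›
  obtain ⟨k0, hk0⟩ := hsat l le_rfl
  have hTb : ∀ m (e : M m), ∀ z ∈ T m x e, W'.pr z = W'.pr (h x) := fun m e z hz => hz.1
  have ha : 0 < (W'.p k0 '' T l x (W.p l x)).ncard := by
    rw [Set.ncard_pos (W'.image_finite k0 _ _ (hTb _ _))]
    exact ⟨_, h x, ⟨rfl, x, rfl, W'.near_refl hr _⟩, rfl⟩
  refine ⟨W.D l * (W'.p k0 '' T l x (W.p l x)).ncard, Nat.mul_pos (W.D_pos l) ha, fun m => ?_⟩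
  rcases le_total m l with hml | hml
  · refine ⟨0, ?_⟩
    rw [← W.D_count m l hml (W.p m x), mul_assoc, mul_assoc]
    exact (dvd_mul_right _ _).mul_left _
  obtain ⟨k1, hk1⟩ := hsat m hml
  refine ⟨max k0 k1, ?_⟩
  set k := max k0 k1 with hk
  have hcount := W'.ncard_saturated (le_max_left k0 k1) (hTb l (W.p l x))
    (hk0 k0 le_rfl x _ (fun w hw => hw))
  rw [← hk] at hcount
  set c := (W'.p k '' T m x (W.p m x)).ncard with hc
  have hI : (W.p m '' (W.p l ⁻¹' {W.p l x})).Finite :=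
    W.image_finite m _ (W.pr x) (fun z hz => W.pr_eq hz)
  have hU : W'.p k '' T l x (W.p l x) =
      ⋃ e ∈ W.p m '' (W.p l ⁻¹' {W.p l x}), W'.p k '' T m x e := by
    ext a
    simp only [Set.mem_iUnion]
    constructor
    · rintro ⟨z, ⟨hz, w, hw, hn⟩, rfl⟩
      exact ⟨W.p m w, ⟨w, hw, rfl⟩, z, ⟨hz, w, rfl, hn⟩, rfl⟩
    · rintro ⟨_, ⟨y, hy, rfl⟩, z, ⟨hz, w, hw, hn⟩, rfl⟩
      exact ⟨z, ⟨hz, w, (W.p_mono' hml hw).trans hy, hn⟩, rfl⟩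
  have hlink : ∀ e ∈ W.p m '' (W.p l ⁻¹' {W.p l x}), ∀ w, W.p m w = e → W.p l w = W.p l x := by
    rintro _ ⟨y, hy, rfl⟩ w hw
    exact (W.p_mono' hml hw).trans hy
  have hUc : (W'.p k '' T l x (W.p l x)).ncard =
      (W.p m '' (W.p l ⁻¹' {W.p l x})).ncard * c := by
    rw [hU]
    refine ncard_disjoint_union hI _ c (fun e _ => W'.image_finite k _ _ (hTb m e)) ?_ ?_
    · intro e he
      have he' := he
      obtain ⟨y, hy, rfl⟩ := he'
      rw [hc, hconst m hml k x y]
      exact hcmp m k _ _ _ _ (hlink _ he) (fun w hw => W.p_mono' hml hw)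
        (fun w hw => ⟨w, hw, W'.near_refl hr _⟩) (fun w hw => ⟨w, hw, W'.near_refl hr _⟩)
    · rintro e he e' he' _ ⟨z, hz, rfl⟩ ⟨z', hz', hzz'⟩
      have hz2 := hk1 k (le_max_right _ _) x e (hlink e he) z hz z' hzz'
      obtain ⟨-, w, hw, hn⟩ := hz2
      obtain ⟨-, w', hw', hn'⟩ := hz'
      have h3 := hinj _ _ ((hn.symm.trans hn').mono hr2)
      rw [h.symm_apply_apply, h.symm_apply_apply] at h3
      have h4 : W.pr w = W.pr w' :=
        W.pr_eq ((hlink e he w hw).trans (hlink e' he' w' hw').symm)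
      rw [← hw, ← hw', W.near_eq le_rfl h3 h4]
  have hDm := W.D_count l m hml (W.p l x)
  refine Dvd.intro (c * W'.D k0) ?_
  rw [mul_assoc, ← hcount, hUc, ← hDm]
  ring

end Tow

/-- The inverse limit of a tower. -/
abbrev SolSp (M : ℕ → Type) (q : ∀ l, M (l + 1) → M l) : Type :=
  { x : ∀ l, M l // ∀ l, q l (x (l + 1)) = x l }

/-- Composite bonding map to the base. -/
def bondComp (M : ℕ → Type) (q : ∀ l, M (l + 1) → M l) : ∀ k, M k → M 0
  | 0 => id
  | k + 1 => fun e => bondComp M q k (q k e)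

section Build

variable {M : ℕ → Type} [∀ l, TopologicalSpace (M l)] {q : ∀ l, M (l + 1) → M l}

theorem bondComp_apply (x : SolSp M q) (k : ℕ) : bondComp M q k (x.1 k) = x.1 0 := by
  induction k with
  | zero => rfl
  | succ k ih =>
    show bondComp M q k (q k (x.1 (k + 1))) = x.1 0
    rw [x.2 k, ih]

theorem bondComp_locInj (hq : ∀ l, IsCoveringMap (q l)) (k : ℕ) :
    IsLocallyInjective (bondComp M q k) := by
  induction k with
  | zero => exact Function.injective_id.IsLocallyInjective
  | succ k ih =>
    intro e
    obtain ⟨U, hU, heU, hUi⟩ := ih (q k e)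
    obtain ⟨V, hV, heV, hVi⟩ := (hq k).isLocalHomeomorph.isLocallyInjective e
    refine ⟨V ∩ q k ⁻¹' U, hV.inter (hU.preimage (hq k).continuous), ⟨heV, heU⟩, ?_⟩
    intro a ha b hb hab
    exact hVi ha.1 hb.1 (hUi ha.2 hb.2 hab)

theorem bondComp_finite (hfin : ∀ l y, ((q l) ⁻¹' {y}).Finite) (k : ℕ) (b : M 0) :
    ((bondComp M q k) ⁻¹' {b}).Finite := by
  induction k with
  | zero => exact Set.finite_singleton b
  | succ k ih =>
    refine (ih.biUnion (fun y _ => hfin k y)).subset ?_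
    intro e he
    exact Set.mem_biUnion (x := q k e) he rfl

/-- Extending a point upward in the tower. -/
theorem proj_surj (hs : ∀ l, Function.Surjective (q l)) (k : ℕ) (e : M k) :
    ∃ x : SolSp M q, x.1 k = e := by
  induction k with
  | zero =>
    choose g hg using hs
    let x : ∀ l, M l := fun l => Nat.rec (motive := M) e (fun l y => g l y) l
    exact ⟨⟨x, fun l => hg l (x l)⟩, rfl⟩
  | succ k ih =>
    -- use the shifted tower
    choose g hg using hs
    let up : ∀ j, {y : M j // True} := fun j => ⟨
      (if h : k + 1 ≤ j then
        Nat.leRec (motive := fun j _ => M j) e (fun l _ y => g l y) h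
      else (ih (q k e)).choose.1 j), trivial⟩
    refine ⟨⟨fun j => (up j).1, fun j => ?_⟩, ?_⟩
    · simp only [up]
      by_cases h : k + 1 ≤ j
      · rw [dif_pos h, dif_pos (h.trans (Nat.le_succ j)), Nat.leRec_succ (h1 := h), hg]
      · rw [dif_neg h]
        by_cases h' : k + 1 ≤ j + 1
        · have : j = k := by omega
          subst this
          rw [dif_pos h', Nat.leRec_self]
          exact (ih (q j e)).choose_spec.symm
        · rw [dif_neg h']
          exact (ih (q k e)).choose.2 j
    · simp only [up]
      rw [dif_pos le_rfl, Nat.leRec_self]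

theorem sol_lift (hq : ∀ l, IsCoveringMap (q l)) {A : Type} [TopologicalSpace A]
    [SimplyConnectedSpace A] [LocallyPathConnectedSpace A] (f : C(A, M 0)) (a0 : A)
    (x : SolSp M q) (hx : f a0 = x.1 0) :
    ∃ F : A → SolSp M q, Continuous F ∧ (∀ a, (F a).1 0 = f a) ∧ F a0 = x := by
  have hstep : ∀ l (g : {g : C(A, M l) // g a0 = x.1 l}),
      ∃ g' : {g : C(A, M (l + 1)) // g a0 = x.1 (l + 1)}, ∀ a, q l (g'.1 a) = g.1 a := by
    intro l g
    obtain ⟨G, ⟨h1, h2⟩, -⟩ := (hq l).existsUnique_continuousMap_lifts g.1 a0 (x.1 (l + 1))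
      (by rw [x.2 l, g.2])
    exact ⟨⟨G, h1⟩, fun a => congrFun h2 a⟩
  choose st hst using hstep
  let G : ∀ l, {g : C(A, M l) // g a0 = x.1 l} := fun l =>
    Nat.rec (motive := fun l => {g : C(A, M l) // g a0 = x.1 l}) ⟨f, hx⟩ (fun l g => st l g) l
  refine ⟨fun a => ⟨fun l => (G l).1 a, fun l => hst l (G l) a⟩, ?_, fun a => rfl, ?_⟩
  · exact Continuous.subtype_mk (continuous_pi fun l => (G l).1.continuous) _
  · exact Subtype.ext (funext fun l => (G l).2)

theorem proj_count (hs : ∀ l, Function.Surjective (q l)) (hfin : ∀ l y, ((q l) ⁻¹' {y}).Finite)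
    (d : ℕ → ℕ) (hdeg : ∀ l (y : M l), Nat.card ((q l) ⁻¹' {y}) = d l) (k m : ℕ) (hkm : k ≤ m)
    (e : M k) :
    ((fun x : SolSp M q => x.1 m) '' {x | x.1 k = e}).Finite ∧
    ((fun x : SolSp M q => x.1 m) '' {x | x.1 k = e}).ncard * ∏ i ∈ Finset.range k, d i =
      ∏ i ∈ Finset.range m, d i := by
  induction m, hkm using Nat.le_induction with
  | base =>
    have : (fun x : SolSp M q => x.1 k) '' {x | x.1 k = e} = {e} := by
      ext y
      constructor
      · rintro ⟨x, hx, rfl⟩; exact hx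
      · rintro rfl
        obtain ⟨x, hx⟩ := proj_surj hs k y
        exact ⟨x, hx, hx⟩
    rw [this]
    simp
  | succ m hkm ih =>
    have hU : (fun x : SolSp M q => x.1 (m + 1)) '' {x | x.1 k = e} =
        ⋃ y ∈ (fun x : SolSp M q => x.1 m) '' {x | x.1 k = e}, q m ⁻¹' {y} := by
      ext y
      simp only [Set.mem_iUnion]
      constructor
      · rintro ⟨x, hx, rfl⟩
        exact ⟨x.1 m, ⟨x, hx, rfl⟩, x.2 m⟩
      · rintro ⟨_, ⟨x, hx, rfl⟩, hy⟩
        obtain ⟨x', hx'⟩ := proj_surj hs (m + 1) y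
        have hm : x'.1 m = x.1 m := by rw [← x'.2 m, hx']; exact hy
        refine ⟨x', ?_, hx'⟩
        have hdown : ∀ j, j ≤ m → x'.1 j = x.1 j := by
          intro j hj
          induction hj using Nat.decreasingInduction with
          | self => exact hm
          | of_succ j _ ih => rw [← x'.2 j, ← x.2 j, ih]
        exact (hdown k hkm).trans hx
    rw [hU]
    refine ⟨ih.1.biUnion fun y _ => hfin m y, ?_⟩
    rw [ncard_disjoint_union ih.1 _ (d m) (fun y _ => hfin m y) (fun y _ => hdeg m y)
      (by rintro i - j - z rfl h; exact h), Finset.prod_range_succ, ← ih.2]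
    ring

theorem exists_tow {n : ℕ} [CompactSpace (M 0)]
    [ChartedSpace (EuclideanSpace ℝ (Fin n)) (M 0)]
    (hq : ∀ l, IsCoveringMap (q l)) (d : ℕ → ℕ) (hd : ∀ l, 1 < d l)
    (hdeg : ∀ l (y : M l), Nat.card ((q l) ⁻¹' {y}) = d l)
    {S X : Type} [MetricSpace S] [MetricSpace X] (iS : S ≃ₜ SolSp M q) (iX : X ≃ₜ M 0) :
    ∃ W : Tow S X M, W.D = fun k => ∏ i ∈ Finset.range k, d i := by
  have hfin : ∀ l y, ((q l) ⁻¹' {y}).Finite := fun l y => by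
    have : Finite ((q l) ⁻¹' {y}) := Nat.finite_of_card_ne_zero (by rw [hdeg]; have := hd l; omega)
    exact Set.toFinite _
  have hs : ∀ l, Function.Surjective (q l) := fun l y => by
    have : Nonempty ((q l) ⁻¹' {y}) := by
      by_contra hne
      rw [not_nonempty_iff] at hne
      have h1 := hdeg l y
      have h2 := hd l
      rw [Nat.card_of_isEmpty] at h1
      omega
    obtain ⟨z, hz⟩ := this
    exact ⟨z, hz⟩
  have : CompactSpace X := iX.symm.compactSpace
  have : LocallyConnectedSpace (M 0) :=
    ChartedSpace.locallyConnectedSpace (EuclideanSpace ℝ (Fin n)) (M 0)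
  have : LocallyConnectedSpace X := iX.locallyConnectedSpace
  have hloc : ∀ ε > 0, ∃ δ > 0, ∀ a b : X, dist a b < δ → ∃ Q : Set X, IsPreconnected Q ∧ a ∈ Q ∧
      b ∈ Q ∧ ∀ a ∈ Q, ∀ b ∈ Q, dist a b < ε := by
    intro ε hε
    have hV := fun x : X => locallyConnectedSpace_iff_subsets_isOpen_isConnected.1 this x
      (Metric.ball x (ε / 2)) (Metric.ball_mem_nhds x (half_pos hε))
    choose V hVb hVo hxV hVc using hV
    obtain ⟨δ, hδ, h⟩ := lebesgue_number_lemma_of_metric (s := Set.univ) isCompact_univ hVo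
      (fun b _ => Set.mem_iUnion.2 ⟨b, hxV b⟩)
    refine ⟨δ, hδ, fun a b hab => ?_⟩
    obtain ⟨i, hi⟩ := h b trivial
    refine ⟨V i, (hVc i).isPreconnected, hi hab, hi (Metric.mem_ball_self hδ), ?_⟩
    intro a ha b hb
    have h1 := Metric.mem_ball.1 (hVb i ha)
    have h2 := Metric.mem_ball.1 (hVb i hb)
    linarith [dist_triangle_right a b i]
  have hlift : ∃ e0 > 0, ∀ Q : Set X, IsPreconnected Q → (∀ a ∈ Q, ∀ b ∈ Q, dist a b < e0) →
      ∀ x : S, iX.symm ((iS x).1 0) ∈ Q → ∃ s : X → S, ContinuousOn s Q ∧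
      (∀ b ∈ Q, iX.symm ((iS (s b)).1 0) = b) ∧ s (iX.symm ((iS x).1 0)) = x := by
    have hV : ∀ b : X, ∃ V : Set X, IsOpen V ∧ b ∈ V ∧
      ∀ x : S, iX.symm ((iS x).1 0) ∈ V → ∃ s : X → S, ContinuousOn s V ∧
      (∀ b ∈ V, iX.symm ((iS (s b)).1 0) = b) ∧ s (iX.symm ((iS x).1 0)) = x := by
      intro b
      let φ := chartAt (EuclideanSpace ℝ (Fin n)) (iX b)
      obtain ⟨ρ, hρ, hball⟩ := Metric.isOpen_iff.1 φ.open_target (φ (iX b))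
        (φ.map_source (mem_chart_source _ _))
      let B := Metric.ball (φ (iX b)) ρ
      have : ContractibleSpace B := Metric.contractibleSpace_ball hρ
      have : LocallyPathConnectedSpace B := Metric.isOpen_ball.locallyPathConnectedSpace
      let V : Set X := iX ⁻¹' (φ.source ∩ φ ⁻¹' B)
      refine ⟨V, (φ.isOpen_inter_preimage Metric.isOpen_ball).preimage iX.continuous,
        ⟨mem_chart_source _ _, Metric.mem_ball_self hρ⟩, fun x hx => ?_⟩
      let f : C(B, M 0) := ⟨fun a => φ.symm a.1,
        φ.continuousOn_symm.comp_continuous continuous_subtype_val (fun a => hball a.2)⟩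
      have hVB : ∀ y, y ∈ V → φ (iX y) ∈ B := fun y hy => hy.2
      have hVs : ∀ y, y ∈ V → iX y ∈ φ.source := fun y hy => hy.1
      have hfV : ∀ y (hy : y ∈ V), f ⟨φ (iX y), hVB y hy⟩ = iX y :=
        fun y hy => φ.left_inv (hVs y hy)
      obtain ⟨F, hF, hF1, hF2⟩ := sol_lift hq f ⟨_, hVB _ hx⟩ (iS x)
        ((hfV _ hx).trans (iX.apply_symm_apply _))
      classical
      let s : X → S := fun y => if hy : y ∈ V then iS.symm (F ⟨φ (iX y), hVB y hy⟩) else x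
      have hsV : ∀ y (hy : y ∈ V), s y = iS.symm (F ⟨φ (iX y), hVB y hy⟩) :=
        fun y hy => dif_pos hy
      refine ⟨s, ?_, ?_, ?_⟩
      · rw [continuousOn_iff_continuous_domRestrict]
        have heq : V.domRestrict s =
            fun y : V => iS.symm (F ⟨φ (iX y.1), hVB y.1 y.2⟩) :=
          funext fun y => hsV y.1 y.2
        rw [heq]
        refine iS.symm.continuous.comp (hF.comp (Continuous.subtype_mk ?_ _))
        exact φ.continuousOn.comp_continuous (iX.continuous.comp continuous_subtype_val)
          (fun y => hVs y.1 y.2)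
      · intro y hy
        rw [hsV y hy, iS.apply_symm_apply, hF1, hfV y hy, iX.symm_apply_apply]
      · rw [hsV _ hx, hF2, iS.symm_apply_apply]
    choose V hVo hxV hVs using hV
    obtain ⟨δ, hδ, h⟩ := lebesgue_number_lemma_of_metric (s := Set.univ) isCompact_univ hVo
      (fun b _ => Set.mem_iUnion.2 ⟨b, hxV b⟩)
    refine ⟨δ, hδ, fun Q _ hd x hx => ?_⟩
    obtain ⟨i, hi⟩ := h _ (Set.mem_univ (iX.symm ((iS x).1 0)))
    have hQ : Q ⊆ V i := fun y hy => hi (hd y hy _ hx)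
    obtain ⟨s, h1, h2, h3⟩ := hVs i x (hQ hx)
    exact ⟨s, h1.mono hQ, fun b hb => h2 b (hQ hb), h3⟩
  obtain ⟨e0, he0, hlift⟩ := hlift
  have hpc : ∀ k, Continuous fun x : S => (iS x).1 k := fun k =>
    (continuous_apply k).comp (continuous_subtype_val.comp iS.continuous)
  refine ⟨{
    p := fun k x => (iS x).1 k
    r := fun k e => iX.symm (bondComp M q k e)
    pr := fun x => iX.symm ((iS x).1 0)
    D := fun k => ∏ i ∈ Finset.range k, d i
    p_cont := hpc
    p_surj := fun k e => by
      obtain ⟨x, hx⟩ := proj_surj hs k e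
      exact ⟨iS.symm x, by simp only [iS.apply_symm_apply, hx]⟩
    r_inj := fun k => (bondComp_locInj hq k).comp_left iX.symm.injective
    r_fin := fun k b => by
      refine (bondComp_finite hfin k (iX b)).subset ?_
      intro e he
      have he' : iX.symm (bondComp M q k e) = b := he
      rw [Set.mem_preimage, Set.mem_singleton_iff, ← he', iX.apply_symm_apply]
    pr_cont := iX.symm.continuous.comp (hpc 0)
    rp := fun k x => by simp only [bondComp_apply]
    p_mono := fun k x y hxy => by
      show (iS x).1 k = (iS y).1 k
      rw [← (iS x).2 k, ← (iS y).2 k]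
      exact congrArg (q k) hxy
    p_sep := fun x y hxy => iS.injective (Subtype.ext (funext hxy))
    D_pos := fun k => Finset.prod_pos fun i _ => (Nat.zero_lt_one.trans (hd i))
    D_count := fun k m hkm e => by
      rw [← (proj_count hs hfin d hdeg k m hkm e).2]
      congr 2
      ext y
      constructor
      · rintro ⟨x, hx, rfl⟩
        exact ⟨iS x, hx, rfl⟩
      · rintro ⟨x, hx, rfl⟩
        exact ⟨iS.symm x, by
          show (iS (iS.symm x)).1 k = e
          rw [iS.apply_symm_apply]
          exact hx,
          by simp only [iS.apply_symm_apply]⟩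
    e0 := e0
    e0_pos := he0
    lift := hlift
    loc := hloc }, rfl⟩

end Build

theorem sol_metrizable {n : ℕ} {M : ℕ → Type} [∀ l, TopologicalSpace (M l)]
    [∀ l, CompactSpace (M l)] [∀ l, T2Space (M l)]
    [∀ l, ChartedSpace (EuclideanSpace ℝ (Fin n)) (M l)] (l : ℕ) :
    TopologicalSpace.MetrizableSpace (M l) := by
  have := ChartedSpace.secondCountable_of_sigmaCompact (EuclideanSpace ℝ (Fin n)) (M l)
  infer_instance

theorem sol_compact {M : ℕ → Type} [∀ l, TopologicalSpace (M l)]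
    [∀ l, CompactSpace (M l)] [∀ l, T2Space (M l)] {q : ∀ l, M (l + 1) → M l}
    (hq : ∀ l, Continuous (q l)) : CompactSpace (SolSp M q) := by
  have hcl : IsClosed {x : ∀ l, M l | ∀ l, q l (x (l + 1)) = x l} := by
    have heq : {x : ∀ l, M l | ∀ l, q l (x (l + 1)) = x l} =
        ⋂ l, {x : ∀ l, M l | q l (x (l + 1)) = x l} := by
      ext x
      simp
    rw [heq]
    exact isClosed_iInter fun l =>
      isClosed_eq ((hq l).comp (continuous_apply _)) (continuous_apply _)
  exact isCompact_iff_compactSpace.1 hcl.isCompact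

theorem sol_dvd {n n' : ℕ}
    (M : ℕ → Type) [∀ ℓ, TopologicalSpace (M ℓ)] [∀ ℓ, CompactSpace (M ℓ)]
    [∀ ℓ, ConnectedSpace (M ℓ)] [∀ ℓ, T2Space (M ℓ)]
    [∀ ℓ, ChartedSpace (EuclideanSpace ℝ (Fin n)) (M ℓ)]
    (M' : ℕ → Type) [∀ ℓ, TopologicalSpace (M' ℓ)] [∀ ℓ, CompactSpace (M' ℓ)]
    [∀ ℓ, T2Space (M' ℓ)]
    [∀ ℓ, ChartedSpace (EuclideanSpace ℝ (Fin n')) (M' ℓ)]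
    (q : ∀ ℓ, M (ℓ + 1) → M ℓ) (hq : ∀ ℓ, IsCoveringMap (q ℓ))
    (d : ℕ → ℕ) (hd : ∀ ℓ, 1 < d ℓ)
    (hdeg : ∀ ℓ (y : M ℓ), Nat.card ((q ℓ) ⁻¹' {y}) = d ℓ)
    (q' : ∀ ℓ, M' (ℓ + 1) → M' ℓ) (hq' : ∀ ℓ, IsCoveringMap (q' ℓ))
    (d' : ℕ → ℕ) (hd' : ∀ ℓ, 1 < d' ℓ)
    (hdeg' : ∀ ℓ (y : M' ℓ), Nat.card ((q' ℓ) ⁻¹' {y}) = d' ℓ)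
    (h : SolSp M q ≃ₜ SolSp M' q') :
    ∃ A > 0, ∀ m, ∃ k, (∏ i ∈ Finset.range m, d i) ∣ A * ∏ i ∈ Finset.range k, d' i := by
  have i1 : ∀ l, TopologicalSpace.MetrizableSpace (M l) := sol_metrizable (n := n)
  have i2 : ∀ l, TopologicalSpace.MetrizableSpace (M' l) := sol_metrizable (n := n')
  have i3 : CompactSpace (SolSp M q) := sol_compact fun l => (hq l).continuous
  have i4 : CompactSpace (SolSp M' q') := sol_compact fun l => (hq' l).continuous
  have i5 : CompactSpace (M 0) := inferInstance
  have i6 : CompactSpace (M' 0) := inferInstance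
  have i7 : TopologicalSpace.MetrizableSpace (SolSp M q) :=
    Topology.IsEmbedding.subtypeVal.metrizableSpace
  have i8 : TopologicalSpace.MetrizableSpace (SolSp M' q') :=
    Topology.IsEmbedding.subtypeVal.metrizableSpace
  letI m1 : MetricSpace (SolSp M q) := TopologicalSpace.metrizableSpaceMetric _
  letI m2 : MetricSpace (SolSp M' q') := TopologicalSpace.metrizableSpaceMetric _
  letI m3 : MetricSpace (M 0) := TopologicalSpace.metrizableSpaceMetric _
  letI m4 : MetricSpace (M' 0) := TopologicalSpace.metrizableSpaceMetric _
  obtain ⟨W, hW⟩ := exists_tow (n := n) hq d hd hdeg (Homeomorph.refl (SolSp M q))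
    (Homeomorph.refl (M 0))
  obtain ⟨W', hW'⟩ := exists_tow (n := n') hq' d' hd' hdeg' (Homeomorph.refl (SolSp M' q'))
    (Homeomorph.refl (M' 0))
  have : Nonempty (SolSp M q) := by
    obtain ⟨e⟩ : Nonempty (M 0) := inferInstance
    exact ⟨(W.p_surj 0 e).choose⟩
  have := W.dvd_main W' h
  rw [hW, hW'] at this
  exact this

theorem steinitz_le {d d' : ℕ → ℕ} (hd' : ∀ l, 1 < d' l) {A : ℕ} (hA : 0 < A)
    (h : ∀ m, ∃ k, (∏ i ∈ Finset.range m, d i) ∣ A * ∏ i ∈ Finset.range k, d' i)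
    (p : Nat.Primes) :
    SteinitzNum.lcmSet (Set.range fun ℓ => ∏ i ∈ Finset.range (ℓ + 1), d i) p ≤
      (A.factorization (p : ℕ) : ℕ∞) +
      SteinitzNum.lcmSet (Set.range fun ℓ => ∏ i ∈ Finset.range (ℓ + 1), d' i) p := by
  have hne : ∀ k, ∏ i ∈ Finset.range k, d' i ≠ 0 := fun k =>
    Finset.prod_ne_zero_iff.2 fun i _ => by have := hd' i; omega
  unfold SteinitzNum.lcmSet
  refine iSup₂_le ?_
  rintro _ ⟨m, rfl⟩
  obtain ⟨k, hk⟩ := h (m + 1)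
  have hk' : (∏ i ∈ Finset.range (m + 1), d i) ∣ A * ∏ i ∈ Finset.range (k + 1), d' i := by
    rw [Finset.prod_range_succ _ k, ← mul_assoc]
    exact hk.mul_right _
  have h1 := (Nat.factorization_le_iff_dvd (ne_zero_of_dvd_ne_zero
    (mul_ne_zero hA.ne' (hne _)) hk') (mul_ne_zero hA.ne' (hne _))).2 hk' (p : ℕ)
  rw [Nat.factorization_mul hA.ne' (hne _), Finsupp.add_apply] at h1
  refine (Nat.cast_le.2 h1).trans ?_
  rw [Nat.cast_add]
  gcongr
  exact le_iSup₂ (f := fun (n : ℕ) (_ : n ∈ Set.range fun ℓ => ∏ i ∈ Finset.range (ℓ + 1), d' i) =>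
    (n.factorization (p : ℕ) : ℕ∞)) _ ⟨k, rfl⟩

theorem asympEquiv_of_le {a b : SteinitzNum} {A B : ℕ} (hA : 0 < A) (hB : 0 < B)
    (h1 : ∀ p : Nat.Primes, a p ≤ (A.factorization (p : ℕ) : ℕ∞) + b p)
    (h2 : ∀ p : Nat.Primes, b p ≤ (B.factorization (p : ℕ) : ℕ∞) + a p) :
    SteinitzNum.AsympEquiv a b := by
  have key : ∀ p : Nat.Primes, ∃ x y : ℕ, (x : ℕ∞) + a p = y + b p ∧
      (¬ (p : ℕ) ∣ A * B → x = 0 ∧ y = 0) := by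
    intro p
    by_cases hp : (p : ℕ) ∣ A * B
    · by_cases ha : a p = ⊤
      · have hb : b p = ⊤ := by
          by_contra hb
          have := h1 p
          rw [ha, top_le_iff] at this
          exact (WithTop.add_ne_top.2 ⟨ENat.coe_ne_top _, hb⟩) this
        exact ⟨0, 0, by rw [ha, hb], fun h => absurd hp h⟩
      · have hb : b p ≠ ⊤ := by
          intro hb
          have := h2 p
          rw [hb, top_le_iff] at this
          exact (WithTop.add_ne_top.2 ⟨ENat.coe_ne_top _, ha⟩) this
        refine ⟨(b p).toNat, (a p).toNat, ?_, fun h => absurd hp h⟩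
        rw [ENat.coe_toNat ha, ENat.coe_toNat hb, add_comm]
    · refine ⟨0, 0, ?_, fun _ => ⟨rfl, rfl⟩⟩
      have hpA : A.factorization (p : ℕ) = 0 :=
        Nat.factorization_eq_zero_of_not_dvd fun h => hp (h.mul_right B)
      have hpB : B.factorization (p : ℕ) = 0 :=
        Nat.factorization_eq_zero_of_not_dvd fun h => hp (h.mul_left A)
      have e1 := h1 p
      have e2 := h2 p
      rw [hpA, Nat.cast_zero, zero_add] at e1
      rw [hpB, Nat.cast_zero, zero_add] at e2
      rw [le_antisymm e1 e2]
  choose x y hxy h0 using key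
  have build : ∀ x : Nat.Primes → ℕ, (∀ p : Nat.Primes, ¬ (p : ℕ) ∣ A * B → x p = 0) →
      ∃ N : ℕ, 0 < N ∧ ∀ p : Nat.Primes, N.factorization (p : ℕ) = x p := by
    classical
    intro x hx
    let f : ℕ →₀ ℕ := Finsupp.onFinset (A * B).primeFactors
      (fun p => if hp : p.Prime then x ⟨p, hp⟩ else 0) (by
        intro p hp
        by_cases hpp : p.Prime
        · rw [dif_pos hpp] at hp
          by_contra hcon
          refine hp (hx ⟨p, hpp⟩ fun hdvd => hcon ?_)
          exact Nat.mem_primeFactors.2 ⟨hpp, hdvd, (Nat.mul_pos hA hB).ne'⟩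
        · rw [dif_neg hpp] at hp; exact absurd rfl hp)
    have hf : ∀ p ∈ f.support, p.Prime := by
      intro p hp
      by_contra hpp
      rw [Finsupp.mem_support_iff] at hp
      exact hp (by simp [f, hpp])
    refine ⟨f.prod (· ^ ·), ?_, fun p => ?_⟩
    · exact Finset.prod_pos fun p hp => pow_pos (hf p hp).pos _
    · rw [Nat.prod_pow_factorization_eq_self hf]
      show (if hp : (p : ℕ).Prime then x ⟨p, hp⟩ else 0) = x p
      exact dif_pos p.2
  obtain ⟨N, hN, hN'⟩ := build x fun p hp => (h0 p hp).1
  obtain ⟨N', hM, hM'⟩ := build y fun p hp => (h0 p hp).2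
  refine ⟨N, N', hN, hM, funext fun p => ?_⟩
  change ((N.factorization (p : ℕ) : ℕ) : ℕ∞) + a p = ((N'.factorization (p : ℕ) : ℕ) : ℕ∞) + b p
  rw [hN', hM', hxy]

/-- If the solenoidal manifolds defined by two presentations (towers of
proper finite covering maps of compact connected manifolds) are homeomorphic, then the
Steinitz orders of the presentations are asymptotically equivalent. -/
theorem steinitzOrder_asympEquiv_of_homeomorphic_solenoids
    {n : ℕ} (hn : 1 ≤ n) {n' : ℕ} (hn' : 1 ≤ n')
    (M : ℕ → Type) [∀ ℓ, TopologicalSpace (M ℓ)] [∀ ℓ, CompactSpace (M ℓ)]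
    [∀ ℓ, ConnectedSpace (M ℓ)] [∀ ℓ, T2Space (M ℓ)]
    [∀ ℓ, ChartedSpace (EuclideanSpace ℝ (Fin n)) (M ℓ)]
    (M' : ℕ → Type) [∀ ℓ, TopologicalSpace (M' ℓ)] [∀ ℓ, CompactSpace (M' ℓ)]
    [∀ ℓ, ConnectedSpace (M' ℓ)] [∀ ℓ, T2Space (M' ℓ)]
    [∀ ℓ, ChartedSpace (EuclideanSpace ℝ (Fin n')) (M' ℓ)]
    (q : ∀ ℓ, M (ℓ + 1) → M ℓ) (hq : ∀ ℓ, IsCoveringMap (q ℓ))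
    (d : ℕ → ℕ) (hd : ∀ ℓ, 1 < d ℓ)
    (hdeg : ∀ ℓ (y : M ℓ), Nat.card ((q ℓ) ⁻¹' {y}) = d ℓ)
    (q' : ∀ ℓ, M' (ℓ + 1) → M' ℓ) (hq' : ∀ ℓ, IsCoveringMap (q' ℓ))
    (d' : ℕ → ℕ) (hd' : ∀ ℓ, 1 < d' ℓ)
    (hdeg' : ∀ ℓ (y : M' ℓ), Nat.card ((q' ℓ) ⁻¹' {y}) = d' ℓ)
    (hhomeo : Nonempty
      (({ x : ∀ ℓ, M ℓ // ∀ ℓ, q ℓ (x (ℓ + 1)) = x ℓ }) ≃ₜ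
        ({ x : ∀ ℓ, M' ℓ // ∀ ℓ, q' ℓ (x (ℓ + 1)) = x ℓ }))) :
    SteinitzNum.AsympEquiv
      (SteinitzNum.lcmSet (Set.range fun ℓ => ∏ i ∈ Finset.range (ℓ + 1), d i))
      (SteinitzNum.lcmSet (Set.range fun ℓ => ∏ i ∈ Finset.range (ℓ + 1), d' i)) := by
  obtain ⟨h⟩ := hhomeo
  obtain ⟨A, hA, hA'⟩ := sol_dvd (n := n) (n' := n') M M' q hq d hd hdeg q' hq' d' hd' hdeg' h
  obtain ⟨B, hB, hB'⟩ := sol_dvd (n := n') (n' := n) M' M q' hq' d' hd' hdeg' q hq d hd hdeg h.symm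
  exact asympEquiv_of_le hA hB (steinitz_le hd' hA hA') (steinitz_le hd hB hB')
end
end
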